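/- arXiv:1302.7127 — 3 statements merged into one kernel-verified Lean document; each statement's English description precedes it below -/
import Mathlib

section
/- Let χ be an order type in general position on a finite set V with |V| = n ≥ 4, and suppose h_1, h_2, h_3 is a convex hull sequence of χ (a triangular convex hull). The family of graphs {T_v : v ∈ V}, all on the common vertex set {t_1, t_2, t_3, t_4} ⊔ (V ∖ {h_1, h_2, h_3}) × {1, 2, 3}, admits a simultaneous geometric embedding if and only if χ is realizable. -/
/-- The 2×2 determinant of two vectors in `ℝ²`. -/
def det2 (x y : ℝ × ℝ) : ℝ := x.1 * y.2 - x.2 * y.1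

/-- An order type in general position on `V`: values in `{-1,+1}` on pairwise distinct
triples and `0` otherwise, alternating, and satisfying the GP axiom. -/
def IsOrderType {V : Type*} (χ : V → V → V → ℤ) : Prop :=
  (∀ a b c : V, a ≠ b → a ≠ c → b ≠ c → χ a b c = 1 ∨ χ a b c = -1) ∧
  (∀ a b c : V, a = b ∨ a = c ∨ b = c → χ a b c = 0) ∧
  (∀ a b c : V, χ b a c = -χ a b c) ∧
  (∀ a b c : V, χ a c b = -χ a b c) ∧
  (∀ x a b c d : V, x ≠ a → x ≠ b → x ≠ c → x ≠ d → a ≠ b → a ≠ c → a ≠ d →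
    b ≠ c → b ≠ d → c ≠ d →
    ((χ x a b * χ x c d = -1 ∨ -(χ x a c * χ x b d) = -1 ∨ χ x a d * χ x b c = -1) ∧
     (χ x a b * χ x c d = 1 ∨ -(χ x a c * χ x b d) = 1 ∨ χ x a d * χ x b c = 1)))

/-- A convex hull sequence of `χ`: a cyclic sequence `h 0, …, h (t-1)` (`t ≥ 3`) of distinct
elements with `χ (h i) (h (i+1)) v = 1` for every `i` (mod `t`) and every other `v`. -/
def IsConvexHullSeq {V : Type*} (χ : V → V → V → ℤ) (t : ℕ) (h : ZMod t → V) : Prop :=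
  3 ≤ t ∧ Function.Injective h ∧
  ∀ i : ZMod t, ∀ v : V, v ≠ h i → v ≠ h (i + 1) → χ (h i) (h (i + 1)) v = 1

/-- A hull element: an element appearing in some convex hull sequence of `χ`. -/
def IsHullElement {V : Type*} (χ : V → V → V → ℤ) (x : V) : Prop :=
  ∃ (t : ℕ) (h : ZMod t → V), IsConvexHullSeq χ t h ∧ x ∈ Set.range h

/-- A hull surrounding sequence of a hull element `h`: an enumeration of `V \ {h}` with
`χ v_j h v_{j+1} = 1` for consecutive entries. -/
def IsHullSurroundSeq {V : Type*} (χ : V → V → V → ℤ) (h : V) (s : List V) : Prop :=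
  s.Nodup ∧ (∀ x : V, x ∈ s ↔ x ≠ h) ∧ s.Chain' (fun a b => χ a h b = 1)

/-- An internal surrounding sequence of a non-hull element `v`: an enumeration of `V \ {v}`
which is cyclically `χ`-increasing around `v`, and with exactly one sign change of
`χ v₁ v ·` along the sequence. -/
def IsInternalSurroundSeq {V : Type*} (χ : V → V → V → ℤ) (v : V) (s : List V) : Prop :=
  s.Nodup ∧ (∀ x : V, x ∈ s ↔ x ≠ v) ∧
  s.Chain' (fun a b => χ a v b = 1) ∧
  (∀ a b : V, s.getLast? = some a → s.head? = some b → χ a v b = 1) ∧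
  ∃! p : ℕ, 0 < p ∧ p + 1 < s.length ∧
    (∀ j : ℕ, 0 < j → j ≤ p → χ (s.getD 0 v) v (s.getD j v) = 1) ∧
    (∀ j : ℕ, p < j → j < s.length → χ (s.getD 0 v) v (s.getD j v) = -1)

/-- The cyclic triangle `h₁, h₂, h₃` as a map `ZMod 3 → V`. -/
def tripleHull {V : Type*} (h₁ h₂ h₃ : V) : ZMod 3 → V :=
  fun i => if i = 0 then h₁ else if i = 1 then h₂ else h₃

/-- The wheel graph `W_v` on `V` determined by the surrounding sequence `s` of `v`:
the cycle through consecutive entries of `s` (taken cyclically) plus all spokes from `v`. -/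
def wheelGraph {V : Type*} (v : V) (s : List V) : SimpleGraph V :=
  SimpleGraph.fromRel (fun a b =>
    (a = v ∧ b ∈ s) ∨
    (∃ i : ℕ, i + 1 < s.length ∧ s.getD i v = a ∧ s.getD (i + 1) v = b) ∨
    (s.getLast? = some a ∧ s.head? = some b))

/-- The vertex set of `T_v`: the four frame vertices `t₁,…,t₄` together with three copies
of the non-hull elements. -/
def TVert (V : Type*) (h₁ h₂ h₃ : V) : Type _ :=
  Fin 4 ⊕ ({x : V // x ≠ h₁ ∧ x ≠ h₂ ∧ x ≠ h₃} × Fin 3)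

/-- The embedding of copy `i` of `V` into the vertex set of `T_v`: a non-hull element `u`
goes to `(u, i)`; the hull `h₁,h₂,h₃` is mapped (with `t₁,t₂,t₃,t₄` being `0,1,2,3`) to
`t₁,t₄,t₃` for copy `0`, to `t₂,t₄,t₁` for copy `1`, and to `t₃,t₄,t₂` for copy `2`. -/
def copyMap {V : Type*} [DecidableEq V] (h₁ h₂ h₃ : V) (i : Fin 3) (u : V) :
    TVert V h₁ h₂ h₃ :=
  if hu : u ≠ h₁ ∧ u ≠ h₂ ∧ u ≠ h₃ then Sum.inr (⟨u, hu⟩, i)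
  else if u = h₂ then Sum.inl 3
  else if u = h₁ then Sum.inl (Fin.castLE (by norm_num) i)
  else Sum.inl (Fin.castLE (by norm_num) (i + 2))

/-- The graph `T_v`: the complete frame on `t₁,…,t₄` together with the images of the three
copies of the wheel graph `W_v` under the copy maps. -/
def TGraph {V : Type*} [DecidableEq V] (h₁ h₂ h₃ : V) (v : V) (s : List V) :
    SimpleGraph (TVert V h₁ h₂ h₃) :=
  SimpleGraph.fromRel (fun a b =>
    (∃ x y : Fin 4, a = Sum.inl x ∧ b = Sum.inl y) ∨
    (∃ (i : Fin 3) (u w : V), (wheelGraph v s).Adj u w ∧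
      a = copyMap h₁ h₂ h₃ i u ∧ b = copyMap h₁ h₂ h₃ i w))

/-- `φ` induces a plane straight-line drawing of `G`: `φ` is injective, any two distinct
edges intersect exactly in the images of their common endpoints, and no vertex image lies
on the closed segment of an edge not containing that vertex. -/
def IsPlaneDrawing {U : Type*} (G : SimpleGraph U) (φ : U → ℝ × ℝ) : Prop :=
  Function.Injective φ ∧
  (∀ a b c d : U, G.Adj a b → G.Adj c d → s(a, b) ≠ s(c, d) →
    segment ℝ (φ a) (φ b) ∩ segment ℝ (φ c) (φ d) =
      φ '' (({a, b} : Set U) ∩ {c, d})) ∧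
  (∀ a b x : U, G.Adj a b → x ≠ a → x ≠ b → φ x ∉ segment ℝ (φ a) (φ b))

/-- `f` realizes the order type `χ` by points in the plane. -/
def Realizes {V : Type*} (χ : V → V → V → ℤ) (f : V → ℝ × ℝ) : Prop :=
  Function.Injective f ∧
  ∀ a b c : V, a ≠ b → a ≠ c → b ≠ c →
    χ a b c = (SignType.sign (det2 (f c - f a) (f b - f a)) : ℤ)

/-- `G` is 3-connected: removing any at most two vertices leaves a connected graph. -/
def ThreeConnected {U : Type*} (G : SimpleGraph U) : Prop :=
  ∀ S : Set U, S.ncard ≤ 2 → (G.induce Sᶜ).Connected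

/-- The wheel graph with rim of length `n`: rim vertices `Fin n` consecutively adjacent
(mod `n`) and a hub adjacent to every rim vertex. -/
def wheel (n : ℕ) : SimpleGraph (Fin n ⊕ Unit) :=
  SimpleGraph.fromRel (fun a b =>
    (∃ i j : Fin n, (j : ℕ) = ((i : ℕ) + 1) % n ∧ a = Sum.inl i ∧ b = Sum.inl j) ∨
    (∃ i : Fin n, a = Sum.inr () ∧ b = Sum.inl i))

/-- No three points of `P` are collinear. -/
def NoThreeCollinear (P : Set (ℝ × ℝ)) : Prop :=
  ∀ a ∈ P, ∀ b ∈ P, ∀ c ∈ P, a ≠ b → a ≠ c → b ≠ c → det2 (b - a) (c - a) ≠ 0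

/-- `q` is a counterclockwise radial order of `P \ {p}` around `p`. -/
def CCWRadialOrder (P : Set (ℝ × ℝ)) (p : ℝ × ℝ) (q : List (ℝ × ℝ)) : Prop :=
  q.Nodup ∧ (∀ x : ℝ × ℝ, x ∈ q ↔ x ∈ P \ {p}) ∧
  ∀ j : ℕ, j < q.length →
    0 < det2 (q.getD j p - p) (q.getD ((j + 1) % q.length) p - p) ∧
    ∀ r ∈ P, r ≠ p → r ≠ q.getD j p → r ≠ q.getD ((j + 1) % q.length) p →
      ¬(0 < det2 (q.getD j p - p) (r - p) ∧
        0 < det2 (r - p) (q.getD ((j + 1) % q.length) p - p))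

/-- The edges (as ordered pairs of endpoints) of the straight-line drawing of the wheel
with hub `p` and rim cycle `q`: the spokes `(p, qⱼ)` and the rim edges `(qⱼ, q_{j+1})`,
indices mod the length of `q`. -/
def wheelEdgePairs (p : ℝ × ℝ) (q : List (ℝ × ℝ)) : Set ((ℝ × ℝ) × (ℝ × ℝ)) :=
  {e | ∃ j : ℕ, j < q.length ∧
    (e = (p, q.getD j p) ∨ e = (q.getD j p, q.getD ((j + 1) % q.length) p))}

/-- The straight-line drawing of the wheel with hub `p` and rim cycle `q` is plane: any two
distinct segments among the spokes and rim edges intersect exactly in their common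
endpoints. -/
def WheelDrawingPlane (p : ℝ × ℝ) (q : List (ℝ × ℝ)) : Prop :=
  ∀ e₁ ∈ wheelEdgePairs p q, ∀ e₂ ∈ wheelEdgePairs p q,
    s(e₁.1, e₁.2) ≠ s(e₂.1, e₂.2) →
    segment ℝ e₁.1 e₁.2 ∩ segment ℝ e₂.1 e₂.2 =
      ({e₁.1, e₁.2} : Set (ℝ × ℝ)) ∩ {e₂.1, e₂.2}

/-- The orientation determinant of three points; positive for clockwise triples. -/
def orient (p q r : ℝ × ℝ) : ℝ := det2 (r - p) (q - p)

theorem orient_swap_left (p q r : ℝ × ℝ) : orient q p r = -orient p q r := by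
  simp only [orient, det2, Prod.fst_sub, Prod.snd_sub]; ring

theorem orient_swap_right (p q r : ℝ × ℝ) : orient p r q = -orient p q r := by
  simp only [orient, det2, Prod.fst_sub, Prod.snd_sub]; ring

theorem orient_rotate (p q r : ℝ × ℝ) : orient q r p = orient p q r := by
  simp only [orient, det2, Prod.fst_sub, Prod.snd_sub]; ring

/-- The three-term Grassmann–Plücker relation for the pencil of directions at `v`. -/
theorem orient_plucker (v p q r s : ℝ × ℝ) :
    orient p v q * orient r v s - orient p v r * orient q v s + orient p v s * orient q v r = 0 := by
  simp only [orient, det2, Prod.fst_sub, Prod.snd_sub]; ring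

/-- `p` lies in the open triangle `A B C`. -/
def InTriangle (p A B C : ℝ × ℝ) : Prop :=
  ∃ α β γ : ℝ, 0 < α ∧ 0 < β ∧ 0 < γ ∧ α + β + γ = 1 ∧ p = α • A + β • B + γ • C

theorem InTriangle.rotate {p A B C : ℝ × ℝ} (h : InTriangle p A B C) : InTriangle p B C A := by
  obtain ⟨α, β, γ, hα, hβ, hγ, hs, rfl⟩ := h
  exact ⟨β, γ, α, hβ, hγ, hα, by linarith, by abel⟩

theorem InTriangle.swap {p A B C : ℝ × ℝ} (h : InTriangle p A B C) : InTriangle p B A C := by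
  obtain ⟨α, β, γ, hα, hβ, hγ, hs, rfl⟩ := h
  exact ⟨β, α, γ, hβ, hα, hγ, by linarith, by abel⟩

theorem exists_barycentric {A B C : ℝ × ℝ} (h : orient A B C ≠ 0) (p : ℝ × ℝ) :
    ∃ α β γ : ℝ, α + β + γ = 1 ∧ p = α • A + β • B + γ • C := by
  refine ⟨orient p B C / orient A B C, orient A p C / orient A B C,
    orient A B p / orient A B C, ?_, ?_⟩
  · rw [← add_div, ← add_div, div_eq_one_iff_eq h]
    simp only [orient, det2, Prod.fst_sub, Prod.snd_sub]; ring
  · apply Prod.ext <;>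
    · simp only [Prod.fst_add, Prod.snd_add, Prod.smul_fst, Prod.smul_snd, smul_eq_mul]
      rw [div_mul_eq_mul_div, div_mul_eq_mul_div, div_mul_eq_mul_div, ← add_div, ← add_div,
        eq_div_iff h]
      simp only [orient, det2, Prod.fst_sub, Prod.snd_sub]; ring

theorem orient_combination {α β γ : ℝ} (hs : α + β + γ = 1) (p q A B C : ℝ × ℝ) :
    orient p q (α • A + β • B + γ • C) =
      α * orient p q A + β * orient p q B + γ * orient p q C := by
  obtain rfl : α = 1 - β - γ := by linarith
  simp only [orient, det2, Prod.fst_sub, Prod.snd_sub, Prod.fst_add, Prod.snd_add,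
    Prod.smul_fst, Prod.smul_snd, smul_eq_mul]
  ring

theorem mem_segment_of_nonneg {α β : ℝ} (hα : 0 ≤ α) (hβ : 0 ≤ β) (hs : α + β = 1)
    {z A B : ℝ × ℝ} (hz : z = α • A + β • B) : z ∈ segment ℝ A B :=
  ⟨α, β, hα, hβ, hs, hz.symm⟩

/-- A segment leaving an open triangle meets one of its sides. -/
theorem exists_mem_side_of_leaves {p q A B C : ℝ × ℝ} (h : orient A B C ≠ 0)
    (hp : InTriangle p A B C) (hq : ¬ InTriangle q A B C) :
    ∃ z ∈ segment ℝ p q, z ∈ segment ℝ A B ∨ z ∈ segment ℝ B C ∨ z ∈ segment ℝ C A := by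
  obtain ⟨α, β, γ, hα, hβ, hγ, hs, hp⟩ := hp
  obtain ⟨α', β', γ', hs', hq'⟩ := exists_barycentric h q
  have hneg : min (min α' β') γ' ≤ 0 := by
    by_contra! hcon
    simp only [lt_min_iff] at hcon
    exact hq ⟨α', β', γ', hcon.1.1, hcon.1.2, hcon.2, hs', hq'⟩
  let F : ℝ → ℝ := fun t =>
    min (min ((1 - t) * α + t * α') ((1 - t) * β + t * β')) ((1 - t) * γ + t * γ')
  have hF : ContinuousOn F (Set.Icc 0 1) := by
    apply Continuous.continuousOn
    fun_prop
  have h0 : F 1 ≤ 0 := by simpa [F] using hneg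
  have h1 : 0 ≤ F 0 := by simp [F, hα.le, hβ.le, hγ.le]
  obtain ⟨t, ⟨ht0, ht1⟩, ht⟩ := intermediate_value_Icc' zero_le_one hF ⟨h0, h1⟩
  have hz : (1 - t) • p + t • q = ((1 - t) * α + t * α') • A + ((1 - t) * β + t * β') • B
      + ((1 - t) * γ + t * γ') • C := by
    rw [hp, hq']; module
  have hsum : ((1 - t) * α + t * α') + ((1 - t) * β + t * β') + ((1 - t) * γ + t * γ') = 1 := by
    linear_combination (1 - t) * hs + t * hs'
  refine ⟨(1 - t) • p + t • q, ⟨1 - t, t, by linarith, ht0, by ring, rfl⟩, ?_⟩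
  rw [hz]
  simp only [F] at ht
  generalize (1 - t) * α + t * α' = a at *
  generalize (1 - t) * β + t * β' = b at *
  generalize (1 - t) * γ + t * γ' = c at *
  have ha : 0 ≤ a := ht ▸ (min_le_left _ _).trans (min_le_left _ _)
  have hb : 0 ≤ b := ht ▸ (min_le_left _ _).trans (min_le_right _ _)
  have hc : 0 ≤ c := ht ▸ min_le_right _ _
  have hzero : a = 0 ∨ b = 0 ∨ c = 0 := by
    rcases min_choice (min a b) c with h | h
    · rcases min_choice a b with h' | h'
      · left; rw [← ht, h, h']
      · right; left; rw [← ht, h, h']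
    · right; right; rw [← ht, h]
  rcases hzero with rfl | rfl | rfl
  · right; left
    exact mem_segment_of_nonneg hb hc (by linarith) (by module)
  · right; right
    exact mem_segment_of_nonneg hc ha (by linarith) (by module)
  · left
    exact mem_segment_of_nonneg ha hb (by linarith) (by module)

/-- A point in the open cone at `v` spanned by `a` and `b` is in the open triangle, or the
segment to it meets the opposite side. -/
theorem inTriangle_or_crosses_of_mem_cone {v a b c : ℝ × ℝ} {x y : ℝ} (hx : 0 < x) (hy : 0 < y)
    (hc : c - v = x • (a - v) + y • (b - v)) :
    InTriangle c v a b ∨ ∃ z ∈ segment ℝ v c, z ∈ segment ℝ a b := by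
  have hc' : c = v + x • (a - v) + y • (b - v) := by
    rw [add_assoc, ← hc]; abel
  by_cases h : x + y < 1
  · left
    exact ⟨1 - x - y, x, y, by linarith, hx, hy, by ring, by rw [hc']; module⟩
  · right
    push Not at h
    have hpos : 0 < x + y := by linarith
    refine ⟨(x / (x + y)) • a + (y / (x + y)) • b, ?_, ?_⟩
    · refine mem_segment_of_nonneg (α := 1 - (x + y)⁻¹) (β := (x + y)⁻¹) ?_ (by positivity)
        (by ring) ?_
      · have := inv_le_one_of_one_le₀ h
        linarith
      · rw [hc']
        have h1 : (x + y)⁻¹ * (x + y) = 1 := inv_mul_cancel₀ hpos.ne'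
        have h2 : x / (x + y) = (x + y)⁻¹ * x := by ring
        have h3 : y / (x + y) = (x + y)⁻¹ * y := by ring
        rw [h2, h3]
        have h4 : (1 - (x + y)⁻¹ * (x + y)) • v = 0 := by rw [h1]; simp
        rw [← sub_eq_zero, ← neg_eq_zero, ← h4]
        module
    · exact mem_segment_of_nonneg (by positivity) (by positivity)
        (by rw [← add_div, div_self hpos.ne']) rfl

/-- Three collinear points: one of them lies on the segment spanned by the other two. -/
theorem mem_segment_of_orient_eq_zero {a b c : ℝ × ℝ} (h : orient a b c = 0) :
    a ∈ segment ℝ b c ∨ b ∈ segment ℝ a c ∨ c ∈ segment ℝ a b := by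
  have key : Collinear ℝ {a, b, c} := by
    by_cases hab : a = b
    · subst hab
      simpa using collinear_pair ℝ a c
    rw [collinear_iff_of_mem (p₀ := a) (by simp)]
    refine ⟨b - a, ?_⟩
    have hne : (b - a).1 ≠ 0 ∨ (b - a).2 ≠ 0 := by
      by_contra! hcon
      exact hab (sub_eq_zero.mp (Prod.ext hcon.1 hcon.2)).symm
    simp only [orient, det2] at h
    have hc : ∃ r : ℝ, c = r • (b - a) + a := by
      rcases hne with hne | hne
      · refine ⟨(c - a).1 / (b - a).1, ?_⟩
        rw [← sub_eq_iff_eq_add]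
        apply Prod.ext
        · simp only [Prod.smul_fst, smul_eq_mul]
          field_simp
        · simp only [Prod.smul_snd, smul_eq_mul]
          field_simp
          linarith
      · refine ⟨(c - a).2 / (b - a).2, ?_⟩
        rw [← sub_eq_iff_eq_add]
        apply Prod.ext
        · simp only [Prod.smul_fst, smul_eq_mul]
          field_simp
          linarith
        · simp only [Prod.smul_snd, smul_eq_mul]
          field_simp
    intro p hp
    rcases hp with rfl | rfl | rfl
    · exact ⟨0, by simp⟩
    · exact ⟨1, by simp⟩
    · simpa using hc
  rcases key.wbtw_or_wbtw_or_wbtw with h | h | h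
  · exact Or.inr (Or.inl h.mem_segment)
  · exact Or.inr (Or.inr (segment_symm ℝ b a ▸ h.mem_segment))
  · exact Or.inl (segment_symm ℝ c b ▸ h.mem_segment)

/-- The vector to `c` expressed in the basis given by `a` and `b`, with origin `v`. -/
theorem sub_eq_combination {v a b : ℝ × ℝ} (h : orient a v b ≠ 0) (c : ℝ × ℝ) :
    c - v = (orient c v b / orient a v b) • (a - v) + (orient a v c / orient a v b) • (b - v) := by
  apply Prod.ext <;>
  · simp only [Prod.fst_add, Prod.snd_add, Prod.smul_fst, Prod.smul_snd, smul_eq_mul]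
    rw [div_mul_eq_mul_div, div_mul_eq_mul_div, ← add_div, eq_div_iff h]
    simp only [orient, det2, Prod.fst_sub, Prod.snd_sub]; ring

theorem IsPlaneDrawing.comp {U W : Type*} {G : SimpleGraph U} {H : SimpleGraph W} {φ : U → ℝ × ℝ}
    (h : IsPlaneDrawing G φ) {c : W → U} (hc : Function.Injective c)
    (hadj : ∀ a b, H.Adj a b → G.Adj (c a) (c b)) : IsPlaneDrawing H (φ ∘ c) := by
  obtain ⟨hinj, hcross, hvert⟩ := h
  refine ⟨hinj.comp hc, fun a b d e hab hde hne => ?_, fun a b x hab hxa hxb =>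
    hvert _ _ _ (hadj _ _ hab) (hc.ne hxa) (hc.ne hxb)⟩
  have hne' : s(c a, c b) ≠ s(c d, c e) := fun heq => hne <| by
    rw [Sym2.eq_iff] at heq ⊢
    exact heq.imp (fun p => ⟨hc p.1, hc p.2⟩) (fun p => ⟨hc p.1, hc p.2⟩)
  have := hcross _ _ _ _ (hadj _ _ hab) (hadj _ _ hde) hne'
  change segment ℝ (φ (c a)) (φ (c b)) ∩ segment ℝ (φ (c d)) (φ (c e)) = _
  rw [this, Set.image_comp, Set.image_inter hc,
    Set.image_pair, Set.image_pair]

theorem IsPlaneDrawing.not_mem_both {U : Type*} {G : SimpleGraph U} {φ : U → ℝ × ℝ}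
    (h : IsPlaneDrawing G φ) {a b c d : U} (hab : G.Adj a b) (hcd : G.Adj c d)
    (hac : a ≠ c) (had : a ≠ d) (hbc : b ≠ c) (hbd : b ≠ d) {z : ℝ × ℝ}
    (hz : z ∈ segment ℝ (φ a) (φ b)) (hz' : z ∈ segment ℝ (φ c) (φ d)) : False := by
  have hne : s(a, b) ≠ s(c, d) := by
    rw [Ne, Sym2.eq_iff]
    tauto
  have hmem : z ∈ segment ℝ (φ a) (φ b) ∩ segment ℝ (φ c) (φ d) := ⟨hz, hz'⟩
  rw [h.2.1 a b c d hab hcd hne] at hmem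
  obtain ⟨x, ⟨hx, hx'⟩, -⟩ := hmem
  rcases hx with rfl | rfl <;> rcases hx' with rfl | rfl <;> contradiction

theorem IsPlaneDrawing.orient_ne_zero {U : Type*} {G : SimpleGraph U} {φ : U → ℝ × ℝ}
    (h : IsPlaneDrawing G φ) {a b c : U} (hab : G.Adj a b) (hbc : G.Adj b c) (hac : G.Adj a c) :
    orient (φ a) (φ b) (φ c) ≠ 0 := by
  intro h0
  rcases mem_segment_of_orient_eq_zero h0 with hm | hm | hm
  · exact h.2.2 _ _ _ hbc hab.ne hac.ne hm
  · exact h.2.2 _ _ _ hac hab.ne' hbc.ne hm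
  · exact h.2.2 _ _ _ hab hac.ne' hbc.ne' hm

/-- In a plane drawing of a triangle and an edge disjoint from it, the open triangle contains
both endpoints of the edge or neither. -/
theorem IsPlaneDrawing.inTriangle_of_adj {U : Type*} {G : SimpleGraph U} {φ : U → ℝ × ℝ}
    (h : IsPlaneDrawing G φ) {a b c p q : U} (hab : G.Adj a b) (hbc : G.Adj b c) (hac : G.Adj a c)
    (hpq : G.Adj p q) (hp : p ≠ a ∧ p ≠ b ∧ p ≠ c) (hq : q ≠ a ∧ q ≠ b ∧ q ≠ c)
    (hin : InTriangle (φ p) (φ a) (φ b) (φ c)) : InTriangle (φ q) (φ a) (φ b) (φ c) := by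
  by_contra hout
  obtain ⟨z, hz, hz' | hz' | hz'⟩ :=
    exists_mem_side_of_leaves (h.orient_ne_zero hab hbc hac) hin hout
  · exact h.not_mem_both hpq hab hp.1 hp.2.1 hq.1 hq.2.1 hz hz'
  · exact h.not_mem_both hpq hbc hp.2.1 hp.2.2 hq.2.1 hq.2.2 hz hz'
  · exact h.not_mem_both hpq hac.symm hp.2.2 hp.1 hq.2.2 hq.1 hz hz'

/-- If `a b c` is a path all of whose vertices are joined to `v`, and neither of the triangles
`v a b`, `v b c` contains the remaining vertex, then the path turns consistently around `v`. -/
theorem IsPlaneDrawing.orient_mul_pos {U : Type*} {G : SimpleGraph U} {φ : U → ℝ × ℝ}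
    (h : IsPlaneDrawing G φ) {v a b c : U} (hva : G.Adj v a) (hvb : G.Adj v b) (hvc : G.Adj v c)
    (hab : G.Adj a b) (hbc : G.Adj b c) (hac : a ≠ c)
    (hc : ¬ InTriangle (φ c) (φ v) (φ a) (φ b)) (ha : ¬ InTriangle (φ a) (φ v) (φ b) (φ c)) :
    0 < orient (φ a) (φ v) (φ b) * orient (φ b) (φ v) (φ c) := by
  have hab0 := h.orient_ne_zero hva.symm hvb hab
  have hbc0 := h.orient_ne_zero hvb.symm hvc hbc
  by_contra! hneg
  have hneg' : 0 < orient (φ c) (φ v) (φ b) / orient (φ a) (φ v) (φ b) := by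
    have h1 : orient (φ c) (φ v) (φ b) = - orient (φ b) (φ v) (φ c) := by
      rw [← orient_rotate, orient_swap_right, ← orient_rotate (φ b)]
    have h2 : orient (φ a) (φ v) (φ b) * orient (φ b) (φ v) (φ c) < 0 :=
      lt_of_le_of_ne hneg (mul_ne_zero hab0 hbc0)
    rw [h1]
    rcases mul_neg_iff.mp h2 with ⟨h3, h4⟩ | ⟨h3, h4⟩
    · exact div_pos (neg_pos.mpr h4) h3
    · exact div_pos_of_neg_of_neg (neg_neg_iff_pos.mpr h4) h3
  have hcomb := sub_eq_combination hab0 (φ c)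
  set x := orient (φ c) (φ v) (φ b) / orient (φ a) (φ v) (φ b)
  set y := orient (φ a) (φ v) (φ c) / orient (φ a) (φ v) (φ b)
  rcases lt_trichotomy y 0 with hy | hy | hy
  · have hcomb' : φ a - φ v = (-y / x) • (φ b - φ v) + (1 / x) • (φ c - φ v) := by
      rw [hcomb, smul_add, smul_smul, smul_smul, one_div_mul_cancel hneg'.ne', ← add_assoc,
        add_right_comm, ← add_smul]
      have : -y / x + 1 / x * y = 0 := by ring
      rw [this]; simp
    rcases inTriangle_or_crosses_of_mem_cone (div_pos (neg_pos.mpr hy) hneg')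
      (one_div_pos.mpr hneg') hcomb' with hin | ⟨z, hz, hz'⟩
    · exact ha hin
    · exact h.not_mem_both hva hbc hvb.ne hvc.ne hab.ne hac hz hz'
  · rw [hy, zero_smul, add_zero] at hcomb
    rcases le_total x 1 with hx | hx
    · refine h.2.2 v a c hva hvc.ne' hac.symm ⟨1 - x, x, by linarith, hneg'.le, by ring, ?_⟩
      rw [← sub_eq_zero, ← sub_eq_zero.mpr hcomb.symm]; module
    · refine h.2.2 v c a hvc hva.ne' hac ⟨1 - 1 / x, 1 / x, ?_, by positivity, by ring, ?_⟩
      · have := (div_le_one hneg').mpr hx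
        linarith
      · have hc' : φ c = φ v + x • (φ a - φ v) := by rw [← hcomb]; abel
        rw [hc', smul_add, smul_smul, one_div_mul_cancel hneg'.ne']; module
  · rcases inTriangle_or_crosses_of_mem_cone hneg' hy hcomb with hin | ⟨z, hz, hz'⟩
    · exact hc hin
    · exact h.not_mem_both hvc hab hva.ne hvb.ne hac.symm hbc.ne' hz hz'

/-- Four points joined by pairwise non-crossing segments: one lies inside the triangle of the
other three. -/
theorem IsPlaneDrawing.exists_inTriangle {U : Type*} {G : SimpleGraph U} {φ : U → ℝ × ℝ}
    (h : IsPlaneDrawing G φ) {a b c d : U} (hab : G.Adj a b) (hac : G.Adj a c) (had : G.Adj a d)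
    (hbc : G.Adj b c) (hbd : G.Adj b d) (hcd : G.Adj c d) :
    InTriangle (φ a) (φ b) (φ c) (φ d) ∨ InTriangle (φ b) (φ a) (φ c) (φ d) ∨
      InTriangle (φ c) (φ a) (φ b) (φ d) ∨ InTriangle (φ d) (φ a) (φ b) (φ c) := by
  have h0 := h.orient_ne_zero hab hbc hac
  obtain ⟨α, β, γ, hs, hd⟩ := exists_barycentric h0 (φ d)
  have hα : α ≠ 0 := by
    rintro rfl
    apply h.orient_ne_zero hbc hcd hbd
    rw [hd, orient_combination hs]
    simp [orient, det2, mul_comm]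
  have hβ : β ≠ 0 := by
    rintro rfl
    apply h.orient_ne_zero hac hcd had
    rw [hd, orient_combination hs]
    simp [orient, det2, mul_comm]
  have hγ : γ ≠ 0 := by
    rintro rfl
    apply h.orient_ne_zero hab hbd had
    rw [hd, orient_combination hs]
    simp [orient, det2, mul_comm]
  -- a negative and two positive coordinates give crossing segments
  have cross : ∀ {α β γ : ℝ} {a b c d : U}, G.Adj a b → G.Adj c d → a ≠ c → a ≠ d → b ≠ c →
      b ≠ d → 0 < α → 0 < β → γ < 0 → α + β + γ = 1 →
      φ d = α • φ a + β • φ b + γ • φ c → False := by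
    intro α β γ a b c d hab hcd hac had hbc hbd hα hβ hγ hs hd
    have hpos : 0 < α + β := by linarith
    refine h.not_mem_both (z := (α / (α + β)) • φ a + (β / (α + β)) • φ b) hab hcd hac had hbc hbd
      (mem_segment_of_nonneg (by positivity) (by positivity)
        (by rw [← add_div, div_self hpos.ne']) rfl)
      (mem_segment_of_nonneg (α := -γ / (α + β)) (β := 1 / (α + β))
        (div_nonneg (by linarith) hpos.le) (by positivity) ?_ ?_)
    · rw [← add_div, div_eq_one_iff_eq hpos.ne']; linarith
    · rw [hd]; module
  -- a positive and two negative coordinates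
  have inside : ∀ {α β γ : ℝ} {A B C D : ℝ × ℝ}, 0 < α → β < 0 → γ < 0 → α + β + γ = 1 →
      D = α • A + β • B + γ • C → InTriangle A B C D := by
    intro α β γ A B C D hα hβ hγ hs hD
    refine ⟨-β / α, -γ / α, 1 / α, div_pos (by linarith) hα, div_pos (by linarith) hα,
      by positivity, ?_, ?_⟩
    · rw [← add_div, ← add_div, div_eq_one_iff_eq hα.ne']; linarith
    · have h1 : (1 / α * α) • A = A := by rw [one_div_mul_cancel hα.ne', one_smul]
      rw [hD]
      nth_rewrite 1 [← h1]
      module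
  rcases hα.lt_or_gt with hα | hα <;> rcases hβ.lt_or_gt with hβ | hβ <;>
    rcases hγ.lt_or_gt with hγ | hγ
  · linarith
  · exact Or.inr (Or.inr (Or.inl (inside hγ hα hβ (by linarith) (by rw [hd]; abel))))
  · exact Or.inr (Or.inl (inside hβ hα hγ (by linarith) (by rw [hd]; abel)))
  · exact (cross hbc had hab.ne' hbd.ne hac.ne' hcd.ne hβ hγ hα (by linarith)
      (by rw [hd]; abel)).elim
  · exact Or.inl (inside hα hβ hγ hs hd)
  · exact (cross hac hbd hab.ne had.ne hbc.ne' hcd.ne hα hγ hβ (by linarith)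
      (by rw [hd]; abel)).elim
  · exact (cross hab hcd hac.ne had.ne hbc.ne hbd.ne hα hβ hγ hs hd).elim
  · exact Or.inr (Or.inr (Or.inr ⟨α, β, γ, hα, hβ, hγ, hs, hd⟩))

/-- Two points cannot each lie in the triangle spanned by the other one and a common side. -/
theorem InTriangle.not_swap_vertex {p q r d : ℝ × ℝ} (h : orient q d r ≠ 0)
    (hp : InTriangle p q r d) : ¬ InTriangle r p q d := by
  obtain ⟨a, b, c, ha, hb, hc, hs, hp⟩ := hp
  rintro ⟨α, β, γ, hα, hβ, hγ, hs', hr⟩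
  have h1 : orient q d p = b * orient q d r := by
    rw [hp, orient_combination hs]
    simp [orient, det2, mul_comm]
  have h2 : orient q d r = α * orient q d p := by
    conv_lhs => rw [hr, orient_combination hs']
    simp [orient, det2, mul_comm]
  have h3 : (1 - α * b) * orient q d r = 0 := by
    rw [h1] at h2; linear_combination h2
  have h4 : α * b < 1 := by nlinarith
  rcases mul_eq_zero.mp h3 with h5 | h5
  · linarith
  · exact h h5

/-- A point `p` of an open triangle subdivides it into three triangles. -/
theorem InTriangle.subdivide {v p q r d : ℝ × ℝ} (hv : InTriangle v q r d)
    (hp : InTriangle p q r d) :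
    InTriangle v p q r ∨ InTriangle v p r d ∨ InTriangle v p q d ∨
      v ∈ segment ℝ p q ∨ v ∈ segment ℝ p r ∨ v ∈ segment ℝ p d := by
  obtain ⟨α, β, γ, hα, hβ, hγ, hs, hv⟩ := hv
  obtain ⟨a, b, c, ha, hb, hc, hs', hp⟩ := hp
  have key : ∀ {α β γ a b c : ℝ} {q r d : ℝ × ℝ}, 0 < α → 0 < a → α + β + γ = 1 →
      a + b + c = 1 → α / a ≤ β / b → α / a ≤ γ / c → 0 < b → 0 < c →
      v = α • q + β • r + γ • d → p = a • q + b • r + c • d →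
      InTriangle v p r d ∨ v ∈ segment ℝ p r ∨ v ∈ segment ℝ p d := by
    intro α β γ a b c q r d hα ha hs hs' h1 h2 hb hc hv hp
    have hk : 0 < α / a := by positivity
    have hka : α / a * a = α := div_mul_cancel₀ α ha.ne'
    rw [le_div_iff₀ hb] at h1
    rw [le_div_iff₀ hc] at h2
    generalize α / a = k at *
    have hvp : v = k • p + (β - k * b) • r + (γ - k * c) • d := by
      rw [hv, hp, ← hka]; module
    have hsum : k + (β - k * b) + (γ - k * c) = 1 := by
      linear_combination hs - k * hs' + hka
    rcases h1.eq_or_lt with h1 | h1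
    · right; right
      refine mem_segment_of_nonneg hk.le (sub_nonneg.mpr h2) (by linarith) ?_
      rw [hvp, h1]; module
    rcases h2.eq_or_lt with h2 | h2
    · right; left
      refine mem_segment_of_nonneg hk.le (sub_nonneg.mpr h1.le) (by linarith) ?_
      rw [hvp, h2]; module
    exact Or.inl ⟨_, _, _, hk, sub_pos.mpr h1, sub_pos.mpr h2, hsum, hvp⟩
  have hmin : (α / a ≤ β / b ∧ α / a ≤ γ / c) ∨ (β / b ≤ α / a ∧ β / b ≤ γ / c) ∨
      (γ / c ≤ α / a ∧ γ / c ≤ β / b) := by grind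
  rcases hmin with ⟨h1, h2⟩ | ⟨h1, h2⟩ | ⟨h1, h2⟩
  · rcases key hα ha hs hs' h1 h2 hb hc hv hp with h | h | h
    · exact Or.inr (Or.inl h)
    · tauto
    · tauto
  · rcases key hβ hb (by linarith) (by linarith) h1 h2 ha hc (r := q) (d := d)
      (by rw [hv]; abel) (by rw [hp]; abel) with h | h | h
    · tauto
    · tauto
    · tauto
  · rcases key hγ hc (by linarith) (by linarith) h1 h2 ha hb (r := q) (d := r)
      (by rw [hv]; abel) (by rw [hp]; abel) with h | h | h
    · tauto
    · tauto
    · tauto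

/-- If `p` is drawn inside the triangle `q r d`, then a vertex joined to `p`, `q` and `r`
is drawn inside the triangle `p q r`. -/
theorem IsPlaneDrawing.inTriangle_of_adj_three {U : Type*} {G : SimpleGraph U} {φ : U → ℝ × ℝ}
    (h : IsPlaneDrawing G φ) {p q r d v : U} (hpq : G.Adj p q) (hpr : G.Adj p r) (hpd : G.Adj p d)
    (hqr : G.Adj q r) (hqd : G.Adj q d) (hrd : G.Adj r d) (hvp : G.Adj v p) (hvq : G.Adj v q)
    (hvr : G.Adj v r) (hvd : v ≠ d) (hin : InTriangle (φ p) (φ q) (φ r) (φ d)) :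
    InTriangle (φ v) (φ p) (φ q) (φ r) := by
  have hv : InTriangle (φ v) (φ q) (φ r) (φ d) :=
    h.inTriangle_of_adj hqr hrd hqd hvp.symm ⟨hpq.ne, hpr.ne, hpd.ne⟩ ⟨hvq.ne, hvr.ne, hvd⟩ hin
  have hnotr : ¬ InTriangle (φ v) (φ p) (φ q) (φ d) := fun hv' =>
    InTriangle.not_swap_vertex (h.orient_ne_zero hqd hrd.symm hqr) hin
      (h.inTriangle_of_adj hpq hqd hpd hvr ⟨hvp.ne, hvq.ne, hvd⟩ ⟨hpr.ne', hqr.ne', hrd.ne⟩ hv')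
  have hnotq : ¬ InTriangle (φ v) (φ p) (φ r) (φ d) := fun hv' =>
    InTriangle.not_swap_vertex (h.orient_ne_zero hrd hqd.symm hqr.symm) hin.swap
      (h.inTriangle_of_adj hpr hrd hpd hvq ⟨hvp.ne, hvr.ne, hvd⟩ ⟨hpq.ne', hqr.ne, hqd.ne⟩ hv')
  rcases hv.subdivide hin with h' | h' | h' | h' | h' | h'
  · exact h'
  · exact (hnotq h').elim
  · exact (hnotr h').elim
  · exact (h.2.2 _ _ _ hpq hvp.ne hvq.ne h').elim
  · exact (h.2.2 _ _ _ hpr hvp.ne hvr.ne h').elim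
  · exact (h.2.2 _ _ _ hpd hvp.ne hvd h').elim

section OrderType

variable {V : Type*} {χ : V → V → V → ℤ}

theorem IsOrderType.ne (h : IsOrderType χ) {a b c : V} (habc : χ a b c = 1) :
    a ≠ b ∧ a ≠ c ∧ b ≠ c := by
  refine ⟨fun e => ?_, fun e => ?_, fun e => ?_⟩ <;>
  · have := h.2.1 a b c (by tauto)
    omega

theorem IsOrderType.rotate (h : IsOrderType χ) (a b c : V) : χ b c a = χ a b c := by
  rw [h.2.2.2.1 b a c, h.2.2.1 a b c, neg_neg]

theorem IsOrderType.swap_ends (h : IsOrderType χ) (a b c : V) : χ c b a = -χ a b c := by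
  rw [h.2.2.1, h.rotate]

theorem IsOrderType.eq_one_of_ne (h : IsOrderType χ) {a b c : V} (hab : a ≠ b) (hac : a ≠ c)
    (hbc : b ≠ c) (hne : χ a b c ≠ 1) : χ c b a = 1 := by
  rcases h.1 a b c hab hac hbc with h' | h'
  · contradiction
  · rw [h.swap_ends, h', neg_neg]

theorem IsOrderType.asymm (h : IsOrderType χ) {a b c : V} (habc : χ a b c = 1) :
    χ c b a ≠ 1 := by
  rw [h.swap_ends]; omega

/-- The sign form of the Grassmann–Plücker relation around `v`. -/
theorem IsOrderType.diagonals (h : IsOrderType χ) {v p q r s : V} (hpq : χ p v q = 1)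
    (hqr : χ q v r = 1) (hrs : χ r v s = 1) (hps : χ p v s = 1) : χ p v r = χ q v s := by
  have h1 := h.ne hpq
  have h2 := h.ne hqr
  have h3 := h.ne hrs
  have h4 := h.ne hps
  have hpr : p ≠ r := by
    rintro rfl
    exact h.asymm hpq hqr
  have hqs : q ≠ s := by
    rintro rfl
    exact h.asymm hqr hrs
  obtain ⟨g1, g2⟩ := h.2.2.2.2 v p q r s h1.1.symm h1.2.2 h3.1.symm h3.2.2 h1.2.1 hpr h4.2.1
    h2.2.1 hqs h3.2.1
  have e : ∀ a b, χ v a b = - χ a v b := fun a b => h.2.2.1 a v b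
  simp only [e, hpq, hqr, hrs, hps] at g1 g2
  rcases h.1 p v r h1.1 hpr h2.2.2 with h5 | h5 <;>
    rcases h.1 q v s h2.1 hqs h3.2.2 with h6 | h6 <;> simp_all

theorem IsOrderType.trans (h : IsOrderType χ) {o v a b c : V} (ha : χ o v a = 1)
    (hb : χ o v b = 1) (hc : χ o v c = 1) (hab : χ a v b = 1) (hbc : χ b v c = 1) :
    χ a v c = 1 :=
  (h.diagonals ha hab hbc hc).symm.trans hb

theorem IsOrderType.trans' (h : IsOrderType χ) {o v a b c : V} (ha : χ a v o = 1)
    (hb : χ b v o = 1) (hc : χ c v o = 1) (hab : χ a v b = 1) (hbc : χ b v c = 1) :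
    χ a v c = 1 :=
  (h.diagonals hab hbc hc ha).trans hb

/-- If a function `D` satisfying the Grassmann–Plücker relation agrees in sign with `χ` on a
base direction `o` and on all pairs of directions consecutive around `v`, then it agrees with
`χ` on the positive side of the base direction. -/
theorem IsOrderType.pos_of_succ [Finite V] (h : IsOrderType χ) {v o : V} {D : V → V → ℝ}
    (hD : ∀ p q r s, D p q * D r s - D p r * D q s + D p s * D q r = 0)
    (hbase : ∀ z, χ o v z = 1 → 0 < D o z)
    (hsucc : ∀ u w, χ u v w = 1 →
      ∃ s, χ u v s = 1 ∧ 0 < D u s ∧ ∀ z, ¬ (χ u v z = 1 ∧ χ z v s = 1))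
    {u w : V} (hu : χ o v u = 1) (hw : χ o v w = 1) (huw : χ u v w = 1) : 0 < D u w := by
  induction hn : {z | χ u v z = 1 ∧ χ z v w = 1}.ncard using Nat.strong_induction_on
    generalizing u with
  | _ n ih =>
    obtain ⟨s, hus, hDus, hempty⟩ := hsucc u w huw
    by_cases hsw : s = w
    · rwa [← hsw]
    have hsw' : χ s v w = 1 :=
      h.eq_one_of_ne (h.ne huw).2.2.symm (Ne.symm hsw) (h.ne hus).2.2 fun hws =>
        hempty w ⟨huw, hws⟩
    have hos : χ o v s = 1 := (h.diagonals hu hus hsw' hw).trans huw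
    have hlt : {z | χ s v z = 1 ∧ χ z v w = 1}.ncard < n := by
      rw [← hn]
      refine Set.ncard_lt_ncard ⟨fun z hz => ⟨?_, hz.2⟩, fun hsub => ?_⟩ (Set.toFinite _)
      · exact (h.diagonals hus hz.1 hz.2 huw).trans hsw'
      · exact h.asymm (hsub ⟨hus, hsw'⟩ : χ s v s = 1 ∧ _).1 (hsub ⟨hus, hsw'⟩ : χ s v s = 1 ∧ _).1
    have h1 := ih _ hlt hos hsw' rfl
    have h2 := hbase u hu
    have h3 := hbase s hos
    have h4 := hbase w hw
    have h5 := hD o u s w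
    have h6 : 0 < D o s * D u w := by
      have := mul_pos h2 h1
      have := mul_pos h4 hDus
      linarith
    exact (pos_iff_pos_of_mul_pos h6).mp h3

end OrderType

/-- A triangular convex hull in clockwise order. -/
def IsHullTriangle {V : Type*} (χ : V → V → V → ℤ) (h₁ h₂ h₃ : V) : Prop :=
  h₁ ≠ h₂ ∧ h₂ ≠ h₃ ∧ h₃ ≠ h₁ ∧ (∀ z, z ≠ h₁ → z ≠ h₂ → χ h₁ h₂ z = 1) ∧
    (∀ z, z ≠ h₂ → z ≠ h₃ → χ h₂ h₃ z = 1) ∧ (∀ z, z ≠ h₃ → z ≠ h₁ → χ h₃ h₁ z = 1)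

theorem IsHullTriangle.rotate {V : Type*} {χ : V → V → V → ℤ} {h₁ h₂ h₃ : V}
    (h : IsHullTriangle χ h₁ h₂ h₃) : IsHullTriangle χ h₂ h₃ h₁ :=
  ⟨h.2.1, h.2.2.1, h.1, h.2.2.2.2.1, h.2.2.2.2.2, h.2.2.2.1⟩

theorem IsConvexHullSeq.isHullTriangle {V : Type*} {χ : V → V → V → ℤ} {h₁ h₂ h₃ : V}
    (h : IsConvexHullSeq χ 3 (tripleHull h₁ h₂ h₃)) : IsHullTriangle χ h₁ h₂ h₃ := by
  obtain ⟨-, hinj, h⟩ := h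
  have e0 : tripleHull h₁ h₂ h₃ 0 = h₁ := rfl
  have e1 : tripleHull h₁ h₂ h₃ 1 = h₂ := rfl
  have e2 : tripleHull h₁ h₂ h₃ 2 = h₃ := rfl
  refine ⟨?_, ?_, ?_, ?_, ?_, ?_⟩
  · exact hinj.ne (a₁ := 0) (a₂ := 1) (by decide)
  · exact hinj.ne (a₁ := 1) (a₂ := 2) (by decide)
  · exact hinj.ne (a₁ := 2) (a₂ := 0) (by decide)
  · exact h 0
  · exact h 1
  · exact h 2

section SurroundSeq

variable {V : Type*} {χ : V → V → V → ℤ} {v : V} {s : List V}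

/-- The entries of a list, read cyclically. -/
def cycEntry (v : V) (s : List V) (i : ℕ) : V := s.getD (i % s.length) v

theorem cycEntry_of_lt {i : ℕ} (hi : i < s.length) : cycEntry v s i = s.getD i v := by
  rw [cycEntry, Nat.mod_eq_of_lt hi]

theorem cycEntry_mod (i : ℕ) : cycEntry v s (i % s.length) = cycEntry v s i := by
  rw [cycEntry, Nat.mod_mod, cycEntry]

theorem cycEntry_eq_getElem {i : ℕ} (hi : i < s.length) : cycEntry v s i = s[i] := by
  rw [cycEntry_of_lt hi, List.getD_eq_getElem _ _ hi]

theorem cycEntry_succ_mod (i : ℕ) :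
    cycEntry v s (i % s.length + 1) = cycEntry v s (i + 1) := by
  rw [cycEntry, cycEntry, Nat.mod_add_mod]

theorem cycEntry_mem (hs : 0 < s.length) (i : ℕ) : cycEntry v s i ∈ s := by
  rw [← cycEntry_mod, cycEntry_eq_getElem (Nat.mod_lt _ hs)]
  exact List.getElem_mem _

theorem cycEntry_inj (hs : 0 < s.length) (hnd : s.Nodup) {i j : ℕ}
    (hij : cycEntry v s i = cycEntry v s j) : i % s.length = j % s.length := by
  rw [← cycEntry_mod, ← cycEntry_mod j, cycEntry_eq_getElem (Nat.mod_lt _ hs),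
    cycEntry_eq_getElem (Nat.mod_lt _ hs)] at hij
  exact (hnd.getElem_inj_iff).mp hij

theorem exists_cycEntry_eq {u : V} (hu : u ∈ s) : ∃ i < s.length, cycEntry v s i = u := by
  obtain ⟨i, hi, rfl⟩ := List.getElem_of_mem hu
  exact ⟨i, hi, cycEntry_eq_getElem hi⟩

theorem length_of_enum [Fintype V] (hnd : s.Nodup) (hmem : ∀ x, x ∈ s ↔ x ≠ v) :
    s.length + 1 = Fintype.card V := by
  classical
  have h1 : s.toFinset = Finset.univ.erase v := by
    ext x; simp [hmem]
  rw [← List.toFinset_card_of_nodup hnd, h1, Finset.card_erase_of_mem (Finset.mem_univ v),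
    Finset.card_univ]
  have : 0 < Fintype.card V := Fintype.card_pos_iff.mpr ⟨v⟩
  omega

theorem getLast?_eq_cycEntry (hs : 0 < s.length) :
    s.getLast? = some (cycEntry v s (s.length - 1)) := by
  rw [cycEntry_eq_getElem (by omega), List.getLast?_eq_getElem?, List.getElem?_eq_getElem]

theorem head?_eq_cycEntry (hs : 0 < s.length) : s.head? = some (cycEntry v s 0) := by
  rw [cycEntry_eq_getElem hs, List.head?_eq_getElem?, List.getElem?_eq_getElem]

theorem wheelGraph_adj_hub (hmem : ∀ x, x ∈ s ↔ x ≠ v) {u : V} (hu : u ≠ v) :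
    (wheelGraph v s).Adj v u := by
  rw [wheelGraph, SimpleGraph.fromRel_adj]
  exact ⟨hu.symm, Or.inl (Or.inl ⟨rfl, (hmem u).mpr hu⟩)⟩

theorem wheelGraph_adj_rim (hs : 2 ≤ s.length) (hnd : s.Nodup) (i : ℕ) :
    (wheelGraph v s).Adj (cycEntry v s i) (cycEntry v s (i + 1)) := by
  rw [wheelGraph, SimpleGraph.fromRel_adj]
  refine ⟨fun h => ?_, Or.inl (Or.inr ?_)⟩
  · have := cycEntry_inj (by omega) hnd h
    have h1 : i ≡ i + 1 [MOD s.length] := this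
    have h2 := (Nat.modEq_iff_dvd' (Nat.le_succ i)).mp h1
    have := Nat.le_of_dvd (by omega) h2
    omega
  · rw [← cycEntry_mod, ← cycEntry_succ_mod]
    have hlt := Nat.mod_lt i (show 0 < s.length by omega)
    generalize i % s.length = k at *
    by_cases hk : k + 1 < s.length
    · left
      exact ⟨k, hk, (cycEntry_of_lt hlt).symm, (cycEntry_of_lt hk).symm⟩
    · right
      obtain rfl : k = s.length - 1 := by omega
      refine ⟨getLast?_eq_cycEntry (by omega), ?_⟩
      rw [head?_eq_cycEntry (v := v) (by omega), ← cycEntry_mod (s.length - 1 + 1),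
        Nat.sub_add_cancel (by omega), Nat.mod_self]

theorem wheelGraph_adj_cases (hs : 0 < s.length) {a b : V} (h : (wheelGraph v s).Adj a b) :
    a = v ∨ b = v ∨ ∃ i < s.length, (a = cycEntry v s i ∧ b = cycEntry v s (i + 1)) ∨
      (b = cycEntry v s i ∧ a = cycEntry v s (i + 1)) := by
  have key : ∀ a b : V, ((a = v ∧ b ∈ s) ∨
      (∃ i : ℕ, i + 1 < s.length ∧ s.getD i v = a ∧ s.getD (i + 1) v = b) ∨
      (s.getLast? = some a ∧ s.head? = some b)) →
      a = v ∨ ∃ i < s.length, a = cycEntry v s i ∧ b = cycEntry v s (i + 1) := by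
    rintro a b (⟨h, -⟩ | ⟨i, hi, rfl, rfl⟩ | ⟨ha, hb⟩)
    · exact Or.inl h
    · exact Or.inr ⟨i, by omega, (cycEntry_of_lt (by omega)).symm, (cycEntry_of_lt hi).symm⟩
    · refine Or.inr ⟨s.length - 1, by omega, ?_, ?_⟩
      · rw [getLast?_eq_cycEntry (v := v) hs] at ha
        exact (Option.some.inj ha).symm
      · rw [head?_eq_cycEntry (v := v) hs] at hb
        rw [← Option.some.inj hb, ← cycEntry_mod (s.length - 1 + 1),
          Nat.sub_add_cancel (by omega), Nat.mod_self]
  rw [wheelGraph, SimpleGraph.fromRel_adj] at h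
  rcases h.2 with h | h
  · rcases key a b h with h | ⟨i, hi, h⟩
    · exact Or.inl h
    · exact Or.inr (Or.inr ⟨i, hi, Or.inl h⟩)
  · rcases key b a h with h | ⟨i, hi, h⟩
    · exact Or.inr (Or.inl h)
    · exact Or.inr (Or.inr ⟨i, hi, Or.inr h⟩)

theorem cycEntry_chain {R : V → V → Prop} (h : s.IsChain R) {i : ℕ} (hi : i + 1 < s.length) :
    R (cycEntry v s i) (cycEntry v s (i + 1)) := by
  rw [cycEntry_eq_getElem hi, cycEntry_eq_getElem (by omega)]
  exact List.isChain_iff_getElem.mp h i hi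

/-- Consecutive entries of a surrounding sequence have no element between them. -/
def IsSuccPair (χ : V → V → V → ℤ) (v a b : V) : Prop :=
  χ a v b = 1 ∧ ∀ z, ¬ (χ a v z = 1 ∧ χ z v b = 1)

theorem IsInternalSurroundSeq.isSuccPair (hχ : IsOrderType χ) (h : IsInternalSurroundSeq χ v s)
    (i : ℕ) : IsSuccPair χ v (cycEntry v s i) (cycEntry v s (i + 1)) := by
  obtain ⟨hnd, hmem, hchain, hwrap, p, ⟨hp0, hp1, hpos, hneg⟩, -⟩ := h
  have hs : 0 < s.length := by omega
  rw [← cycEntry_mod, ← cycEntry_succ_mod]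
  have hlt := Nat.mod_lt i hs
  generalize i % s.length = j at *
  clear i
  have hc : ∀ i, i + 1 < s.length → χ (cycEntry v s i) v (cycEntry v s (i + 1)) = 1 :=
    fun i hi => cycEntry_chain hchain hi
  have hw := hwrap _ _ (getLast?_eq_cycEntry (v := v) hs) (head?_eq_cycEntry (v := v) hs)
  have hpos' : ∀ j, 0 < j → j ≤ p → χ (cycEntry v s 0) v (cycEntry v s j) = 1 := by
    intro j h0 h1
    rw [cycEntry_of_lt hs, cycEntry_of_lt (by omega)]
    exact hpos j h0 h1
  have hneg' : ∀ j, p < j → j < s.length → χ (cycEntry v s j) v (cycEntry v s 0) = 1 := by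
    intro j h0 h1
    rw [hχ.swap_ends, cycEntry_of_lt hs, cycEntry_of_lt (by omega), hneg j h0 h1, neg_neg]
  have hsurj : ∀ z, z ≠ v → ∃ k < s.length, cycEntry v s k = z :=
    fun z hz => exists_cycEntry_eq ((hmem z).mpr hz)
  have hwrapidx : cycEntry v s (s.length - 1 + 1) = cycEntry v s 0 := by
    rw [← cycEntry_mod (s.length - 1 + 1), Nat.sub_add_cancel (by omega), Nat.mod_self]
  generalize cycEntry v s = e at *
  have sorted1 : ∀ i j, i < j → j ≤ p → χ (e i) v (e j) = 1 := by
    intro i j hij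
    induction j, hij using Nat.le_induction with
    | base => exact fun hj => hc i (by omega)
    | succ j hij ih =>
      intro hj
      rcases Nat.eq_zero_or_pos i with rfl | hi
      · exact hpos' _ (by omega) hj
      · exact hχ.trans (hpos' i hi (by omega)) (hpos' j (by omega) (by omega))
          (hpos' (j + 1) (by omega) hj) (ih (by omega)) (hc j (by omega))
  have sorted2 : ∀ i j, p < i → i < j → j < s.length → χ (e i) v (e j) = 1 := by
    intro i j hi hij
    induction j, hij using Nat.le_induction with
    | base => exact fun hj => hc i (by omega)
    | succ j hij ih =>
      intro hj
      exact hχ.trans' (hneg' i hi (by omega)) (hneg' j (by omega) (by omega))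
          (hneg' (j + 1) (by omega) hj) (ih (by omega)) (hc j (by omega))
  by_cases hj : j + 1 < s.length
  · refine ⟨hc j hj, ?_⟩
    rintro z ⟨h1, h2⟩
    obtain ⟨k, hk, rfl⟩ := hsurj z (hχ.ne h1).2.2.symm
    have hjk : j ≠ k := fun e' => (hχ.ne h1).2.1 (by rw [e'])
    have hjk' : k ≠ j + 1 := fun e' => (hχ.ne h2).2.1 (by rw [e'])
    have nlt1 : ¬ (k < j ∧ j ≤ p) := fun h' => hχ.asymm h1 (sorted1 k j h'.1 h'.2)
    have nlt2 : ¬ (j + 1 < k ∧ k ≤ p) := fun h' => hχ.asymm h2 (sorted1 _ _ h'.1 h'.2)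
    have nlt3 : ¬ (p < k ∧ k < j) := fun h' => hχ.asymm h1 (sorted2 k j h'.1 h'.2 (by omega))
    have nlt4 : ¬ (p < j + 1 ∧ j + 1 < k) := fun h' => hχ.asymm h2 (sorted2 _ _ h'.1 h'.2 hk)
    by_cases hjp : j < p
    · have hpk : p < k := by omega
      rcases Nat.eq_zero_or_pos j with rfl | hj0
      · exact hχ.asymm h1 (hneg' k hpk hk)
      · have := hχ.diagonals (hpos' j hj0 hjp.le) h1 h2 (hpos' (j + 1) (by omega) (by omega))
        rw [hc j hj] at this
        exact hχ.asymm this (hneg' k hpk hk)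
    · have hkp : k ≤ p := by omega
      have hpj : p < j := by omega
      rcases Nat.eq_zero_or_pos k with rfl | hk0
      · exact hχ.asymm h2 (hneg' (j + 1) (by omega) hj)
      · have := hχ.diagonals h1 h2 (hneg' (j + 1) (by omega) hj) (hneg' j hpj hlt)
        rw [hc j hj] at this
        exact hχ.asymm this.symm (hpos' k hk0 hkp)
  · obtain rfl : j = s.length - 1 := by omega
    rw [hwrapidx]
    refine ⟨hw, ?_⟩
    rintro z ⟨h1, h2⟩
    obtain ⟨k, hk, rfl⟩ := hsurj z (hχ.ne h1).2.2.symm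
    have hk' : k ≠ s.length - 1 := fun e' => (hχ.ne h1).2.1 (by rw [e'])
    have hk0 : k ≠ 0 := fun e' => (hχ.ne h2).2.1 (by rw [e'])
    by_cases hkp : k ≤ p
    · exact hχ.asymm h2 (hpos' k (by omega) hkp)
    · exact hχ.asymm h1 (sorted2 k _ (by omega) (by omega) hlt)

theorem IsHullSurroundSeq.entry_zero (hχ : IsOrderType χ) {h₂ h₃ : V}
    (ht : IsHullTriangle χ v h₂ h₃) (h : IsHullSurroundSeq χ v s) : cycEntry v s 0 = h₃ := by
  obtain ⟨hnd, hmem, hchain⟩ := h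
  obtain ⟨k, hk, hk3⟩ := exists_cycEntry_eq (v := v) ((hmem h₃).mpr ht.2.2.1)
  rcases Nat.eq_zero_or_pos k with rfl | hpos
  · exact hk3
  · have h1 := cycEntry_chain (v := v) hchain (i := k - 1) (by omega)
    rw [Nat.sub_add_cancel hpos, hk3] at h1
    exact (hχ.asymm h1 (ht.2.2.2.2.2 _ (hχ.ne h1).2.1 (hχ.ne h1).1)).elim

theorem IsHullSurroundSeq.entry_last (hχ : IsOrderType χ) {h₂ h₃ : V}
    (ht : IsHullTriangle χ v h₂ h₃) (h : IsHullSurroundSeq χ v s) :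
    cycEntry v s (s.length - 1) = h₂ := by
  obtain ⟨hnd, hmem, hchain⟩ := h
  obtain ⟨k, hk, hk2⟩ := exists_cycEntry_eq (v := v) ((hmem h₂).mpr ht.1.symm)
  by_cases hlast : k + 1 < s.length
  · have h1 := cycEntry_chain (v := v) hchain hlast
    rw [hk2] at h1
    have h2 := ht.2.2.2.1 _ (hχ.ne h1).2.2.symm (hχ.ne h1).2.1.symm
    rw [hχ.2.2.1, h2] at h1
    omega
  · rwa [show s.length - 1 = k by omega]

theorem IsHullSurroundSeq.isSuccPair (hχ : IsOrderType χ) {h₂ h₃ : V}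
    (ht : IsHullTriangle χ v h₂ h₃) (h : IsHullSurroundSeq χ v s) {i : ℕ}
    (hi : i + 1 < s.length) : IsSuccPair χ v (cycEntry v s i) (cycEntry v s (i + 1)) := by
  have hfirst := h.entry_zero hχ ht
  obtain ⟨hnd, hmem, hchain⟩ := h
  have hs : 0 < s.length := by omega
  have hc : ∀ i, i + 1 < s.length → χ (cycEntry v s i) v (cycEntry v s (i + 1)) = 1 :=
    fun i hi => cycEntry_chain hchain hi
  have hbase : ∀ j, 0 < j → j < s.length → χ (cycEntry v s 0) v (cycEntry v s j) = 1 := by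
    intro j hj hjs
    rw [hfirst]
    refine ht.2.2.2.2.2 _ (fun e => ?_) ((hmem _).mp (cycEntry_mem hs j))
    rw [← hfirst] at e
    have := cycEntry_inj hs hnd e
    rw [Nat.mod_eq_of_lt hjs, Nat.zero_mod] at this
    omega
  have sorted : ∀ i j, i < j → j < s.length → χ (cycEntry v s i) v (cycEntry v s j) = 1 := by
    intro i j hij
    induction j, hij using Nat.le_induction with
    | base => exact fun hj => hc i (by omega)
    | succ j hij ih =>
      intro hj
      rcases Nat.eq_zero_or_pos i with rfl | hi
      · exact hbase _ (by omega) hj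
      · exact hχ.trans (hbase i hi (by omega)) (hbase j (by omega) (by omega))
          (hbase (j + 1) (by omega) hj) (ih (by omega)) (hc j (by omega))
  refine ⟨hc i hi, ?_⟩
  rintro z ⟨h1, h2⟩
  obtain ⟨k, hk, rfl⟩ := exists_cycEntry_eq (v := v) ((hmem z).mpr (hχ.ne h1).2.2.symm)
  rcases lt_trichotomy k i with hki | rfl | hki
  · exact hχ.asymm h1 (sorted k i hki (by omega))
  · exact (hχ.ne h1).2.1 rfl
  · rcases (Nat.succ_le_of_lt hki).eq_or_lt with e | hlt
    · exact (hχ.ne h2).2.1 (by rw [← e])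
    · exact hχ.asymm h2 (sorted _ _ hlt hk)

end SurroundSeq

section DrawnWheels

variable {V : Type*}

/-- The orientation of three drawn points, up to the global sign `ε`. -/
def drawnOrient (ε : ℝ) (g : V → ℝ × ℝ) (a b c : V) : ℝ := ε * orient (g a) (g b) (g c)

theorem drawnOrient_rotate (ε : ℝ) (g : V → ℝ × ℝ) (a b c : V) :
    drawnOrient ε g b c a = drawnOrient ε g a b c := by
  rw [drawnOrient, orient_rotate, drawnOrient]

theorem drawnOrient_plucker (ε : ℝ) (g : V → ℝ × ℝ) (v p q r s : V) :
    drawnOrient ε g p v q * drawnOrient ε g r v s - drawnOrient ε g p v r * drawnOrient ε g q v s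
      + drawnOrient ε g p v s * drawnOrient ε g q v r = 0 := by
  simp only [drawnOrient]
  linear_combination ε ^ 2 * orient_plucker (g v) (g p) (g q) (g r) (g s)

/-- All drawn points other than the corners lie inside the triangle `h₁ h₂ h₃`. -/
def IsDrawnHull (ε : ℝ) (g : V → ℝ × ℝ) (h₁ h₂ h₃ : V) : Prop :=
  (∀ z, z ≠ h₁ → z ≠ h₂ → 0 < drawnOrient ε g h₁ h₂ z) ∧
  (∀ z, z ≠ h₂ → z ≠ h₃ → 0 < drawnOrient ε g h₂ h₃ z) ∧
  (∀ z, z ≠ h₃ → z ≠ h₁ → 0 < drawnOrient ε g h₃ h₁ z)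

theorem IsDrawnHull.rotate {ε : ℝ} {g : V → ℝ × ℝ} {h₁ h₂ h₃ : V}
    (h : IsDrawnHull ε g h₁ h₂ h₃) : IsDrawnHull ε g h₂ h₃ h₁ :=
  ⟨h.2.1, h.2.2, h.1⟩

theorem IsDrawnHull.not_inTriangle {ε : ℝ} {g : V → ℝ × ℝ} {h₁ h₂ h₃ : V}
    (h : IsDrawnHull ε g h₁ h₂ h₃) {v a b : V} (hva : v ≠ a) (hv : h₁ ≠ v) (ha : h₁ ≠ a)
    (hb : h₁ ≠ b) : ¬ InTriangle (g h₁) (g v) (g a) (g b) := by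
  rintro ⟨α, β, γ, hα, hβ, hγ, hs, he⟩
  have h0 : drawnOrient ε g h₃ h₁ h₁ = 0 := by simp [drawnOrient, orient, det2, mul_comm]
  have h3 : drawnOrient ε g h₃ h₁ h₃ = 0 := by simp [drawnOrient, orient, det2]
  have hnonneg : ∀ z, z ≠ h₁ → 0 ≤ drawnOrient ε g h₃ h₁ z := by
    intro z hz
    by_cases hz3 : z = h₃
    · rw [hz3, h3]
    · exact (h.2.2 z hz3 hz).le
  have hsum : drawnOrient ε g h₃ h₁ h₁ = α * drawnOrient ε g h₃ h₁ v +
      β * drawnOrient ε g h₃ h₁ a + γ * drawnOrient ε g h₃ h₁ b := by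
    have := orient_combination hs (g h₃) (g h₁) (g v) (g a) (g b)
    rw [← he] at this
    simp only [drawnOrient, this]
    ring
  have hv0 := mul_nonneg hα.le (hnonneg v hv.symm)
  have ha0 := mul_nonneg hβ.le (hnonneg a ha.symm)
  have hb0 := mul_nonneg hγ.le (hnonneg b hb.symm)
  by_cases hv3 : v = h₃
  · have := mul_pos hβ (h.2.2 a (fun e => hva (hv3.trans e.symm)) ha.symm)
    linarith
  · have := mul_pos hα (h.2.2 v hv3 hv.symm)
    linarith

/-- Any corner of the drawn hull avoiding a triangle is not inside it. -/
theorem IsDrawnHull.not_inTriangle_of_mem {ε : ℝ} {g : V → ℝ × ℝ} {h₁ h₂ h₃ h : V}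
    (hd : IsDrawnHull ε g h₁ h₂ h₃) (hh : h = h₁ ∨ h = h₂ ∨ h = h₃) {v a b : V} (hva : v ≠ a)
    (hv : h ≠ v) (ha : h ≠ a) (hb : h ≠ b) : ¬ InTriangle (g h) (g v) (g a) (g b) := by
  rcases hh with rfl | rfl | rfl
  · exact hd.not_inTriangle hva hv ha hb
  · exact hd.rotate.not_inTriangle hva hv ha hb
  · exact hd.rotate.rotate.not_inTriangle hva hv ha hb

theorem cycEntry_ne {v : V} {s : List V} (hnd : s.Nodup) {i k : ℕ} (hik : i < k)
    (hk : k < i + s.length) : cycEntry v s i ≠ cycEntry v s k := by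
  intro h
  have h1 : i ≡ k [MOD s.length] := cycEntry_inj (by omega) hnd h
  have := Nat.le_of_dvd (by omega) ((Nat.modEq_iff_dvd' hik.le).mp h1)
  omega

theorem exists_cycEntry_offset_eq {v : V} {s : List V} (j : ℕ) {u : V} (hu : u ∈ s) :
    ∃ i < s.length, cycEntry v s (j + i) = u := by
  obtain ⟨k, hk, rfl⟩ := exists_cycEntry_eq (v := v) hu
  have hj := Nat.mod_lt j (show 0 < s.length by omega)
  by_cases h : j % s.length ≤ k
  · refine ⟨k - j % s.length, by omega, ?_⟩
    rw [← cycEntry_mod, ← Nat.mod_add_mod, Nat.add_sub_cancel' h, cycEntry_mod]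
  · refine ⟨k + s.length - j % s.length, by omega, ?_⟩
    rw [← cycEntry_mod, ← Nat.mod_add_mod, Nat.add_sub_cancel' (by omega), Nat.add_mod_right,
      cycEntry_mod]

/-- In a plane drawing of a wheel, a triangle spanned by the hub and a rim edge that misses some
vertex misses all vertices. -/
theorem not_inTriangle_of_rim {g : V → ℝ × ℝ} {v : V} {s : List V} (hs : 3 ≤ s.length)
    (hnd : s.Nodup) (hmem : ∀ x, x ∈ s ↔ x ≠ v) (hg : IsPlaneDrawing (wheelGraph v s) g) {j : ℕ}
    {h : V} (hv : h ≠ v) (ha : h ≠ cycEntry v s j) (hb : h ≠ cycEntry v s (j + 1))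
    (hout : ¬ InTriangle (g h) (g v) (g (cycEntry v s j)) (g (cycEntry v s (j + 1))))
    {c : V} (hcv : c ≠ v) (hca : c ≠ cycEntry v s j) (hcb : c ≠ cycEntry v s (j + 1)) :
    ¬ InTriangle (g c) (g v) (g (cycEntry v s j)) (g (cycEntry v s (j + 1))) := by
  intro hin
  have hne : ∀ i, cycEntry v s i ≠ v := fun i => (hmem _).mp (cycEntry_mem (by omega) i)
  have offset : ∀ u, u ≠ v → u ≠ cycEntry v s j → u ≠ cycEntry v s (j + 1) →
      ∃ i, 2 ≤ i ∧ i < s.length ∧ cycEntry v s (j + i) = u := by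
    intro u h1 h2 h3
    obtain ⟨i, hi, rfl⟩ := exists_cycEntry_offset_eq (v := v) j ((hmem u).mpr h1)
    refine ⟨i, ?_, hi, rfl⟩
    by_contra! hlt
    interval_cases i
    · exact h2 rfl
    · exact h3 rfl
  have avoid : ∀ i, 2 ≤ i → i < s.length → cycEntry v s (j + i) ≠ v ∧
      cycEntry v s (j + i) ≠ cycEntry v s j ∧ cycEntry v s (j + i) ≠ cycEntry v s (j + 1) :=
    fun i h1 h2 => ⟨hne _, (cycEntry_ne hnd (by omega) (by omega)).symm,
      (cycEntry_ne hnd (by omega) (by omega)).symm⟩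
  have hva := wheelGraph_adj_hub hmem (hne j)
  have hvb := wheelGraph_adj_hub hmem (hne (j + 1))
  have hab := wheelGraph_adj_rim (v := v) (by omega) hnd j
  obtain ⟨i₀, h2, h3, rfl⟩ := offset c hcv hca hcb
  obtain ⟨i₁, h2', h3', rfl⟩ := offset h hv ha hb
  have up : ∀ i, i₀ ≤ i → i < s.length → InTriangle (g (cycEntry v s (j + i))) (g v)
      (g (cycEntry v s j)) (g (cycEntry v s (j + 1))) := by
    intro i hi
    induction i, hi using Nat.le_induction with
    | base => exact fun _ => hin
    | succ i hi ih =>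
      exact fun hlt => hg.inTriangle_of_adj hva hab hvb (wheelGraph_adj_rim (by omega) hnd (j + i))
        (avoid i (by omega) (by omega)) (avoid (i + 1) (by omega) hlt) (ih (by omega))
  have down : ∀ k, k + 2 ≤ i₀ → InTriangle (g (cycEntry v s (j + (i₀ - k)))) (g v)
      (g (cycEntry v s j)) (g (cycEntry v s (j + 1))) := by
    intro k
    induction k with
    | zero => exact fun _ => hin
    | succ k ih =>
      intro hk
      refine hg.inTriangle_of_adj hva hab hvb ?_
        (avoid (i₀ - k) (by omega) (by omega)) (avoid (i₀ - (k + 1)) (by omega) (by omega))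
        (ih (by omega))
      have := (wheelGraph_adj_rim (v := v) (by omega) hnd (j + (i₀ - (k + 1)))).symm
      rwa [show j + (i₀ - (k + 1)) + 1 = j + (i₀ - k) by omega] at this
  apply hout
  rcases le_total i₀ i₁ with hle | hle
  · exact up i₁ hle h3'
  · have := down (i₀ - i₁) (by omega)
    rwa [show i₀ - (i₀ - i₁) = i₁ by omega] at this

/-- Consecutive rim edges turn the same way around the hub. -/
theorem drawnOrient_succ_pos {ε : ℝ} {g : V → ℝ × ℝ} {v h₁ h₂ h₃ : V} {s : List V}
    (hd : IsDrawnHull ε g h₁ h₂ h₃) (hs : 3 ≤ s.length)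
    (hnd : s.Nodup) (hmem : ∀ x, x ∈ s ↔ x ≠ v) (hg : IsPlaneDrawing (wheelGraph v s) g)
    {j : ℕ} {h h' : V} (hh : h = h₁ ∨ h = h₂ ∨ h = h₃) (hh' : h' = h₁ ∨ h' = h₂ ∨ h' = h₃)
    (h0 : h ≠ v ∧ h ≠ cycEntry v s j ∧ h ≠ cycEntry v s (j + 1))
    (h1 : h' ≠ v ∧ h' ≠ cycEntry v s (j + 1) ∧ h' ≠ cycEntry v s (j + 2))
    (hpos : 0 < drawnOrient ε g (cycEntry v s j) v (cycEntry v s (j + 1))) :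
    0 < drawnOrient ε g (cycEntry v s (j + 1)) v (cycEntry v s (j + 2)) := by
  have hne : ∀ i, cycEntry v s i ≠ v := fun i => (hmem _).mp (cycEntry_mem (by omega) i)
  have hca : cycEntry v s j ≠ cycEntry v s (j + 2) := cycEntry_ne hnd (by omega) (by omega)
  have hab := wheelGraph_adj_rim (v := v) (by omega) hnd j
  have hbc := wheelGraph_adj_rim (v := v) (by omega) hnd (j + 1)
  have key := hg.orient_mul_pos (wheelGraph_adj_hub hmem (hne j))
    (wheelGraph_adj_hub hmem (hne (j + 1))) (wheelGraph_adj_hub hmem (hne (j + 2))) hab hbc hca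
    (not_inTriangle_of_rim hs hnd hmem hg h0.1 h0.2.1 h0.2.2
      (hd.not_inTriangle_of_mem hh (hne j).symm h0.1 h0.2.1 h0.2.2) (hne _) hca.symm hbc.ne')
    (not_inTriangle_of_rim hs hnd hmem hg h1.1 h1.2.1 h1.2.2
      (hd.not_inTriangle_of_mem hh' (hne _).symm h1.1 h1.2.1 h1.2.2) (hne _) hab.ne hca)
  have h2 : 0 < ε ^ 2 * (orient (g (cycEntry v s j)) (g v) (g (cycEntry v s (j + 1))) *
      orient (g (cycEntry v s (j + 1))) (g v) (g (cycEntry v s (j + 2)))) := by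
    refine mul_pos (sq_pos_of_ne_zero ?_) key
    rintro rfl
    simp [drawnOrient] at hpos
  have h3 : 0 < drawnOrient ε g (cycEntry v s j) v (cycEntry v s (j + 1)) *
      drawnOrient ε g (cycEntry v s (j + 1)) v (cycEntry v s (j + 2)) := by
    simp only [drawnOrient]
    linarith
  exact (pos_iff_pos_of_mul_pos h3).mp hpos

variable [Fintype V] {χ : V → V → V → ℤ}

theorem pos_of_hull_center (hχ : IsOrderType χ) (hn : 4 ≤ Fintype.card V) {h₁ h₂ h₃ : V}
    (ht : IsHullTriangle χ h₁ h₂ h₃) {ε : ℝ} {g : V → ℝ × ℝ} (hd : IsDrawnHull ε g h₁ h₂ h₃)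
    {s : List V} (hseq : IsHullSurroundSeq χ h₁ s) (hg : IsPlaneDrawing (wheelGraph h₁ s) g)
    {u w : V} (huw : χ u h₁ w = 1) : 0 < drawnOrient ε g u h₁ w := by
  have hlen := length_of_enum hseq.1 hseq.2.1
  have hfirst := hseq.entry_zero hχ ht
  have hlast := hseq.entry_last hχ ht
  have hne : ∀ i, cycEntry h₁ s i ≠ h₁ :=
    fun i => (hseq.2.1 _).mp (cycEntry_mem (by omega) i)
  have hentry : ∀ i j, i < j → j < s.length → cycEntry h₁ s i ≠ cycEntry h₁ s j :=
    fun i j hij hj => cycEntry_ne hseq.1 hij (by omega)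
  have hbase : ∀ z, χ h₃ h₁ z = 1 → 0 < drawnOrient ε g h₃ h₁ z :=
    fun z hz => hd.2.2 z (hχ.ne hz).2.1.symm (hχ.ne hz).2.2.symm
  have hpos : ∀ i, i + 1 < s.length →
      0 < drawnOrient ε g (cycEntry h₁ s i) h₁ (cycEntry h₁ s (i + 1)) := by
    intro i
    induction i with
    | zero =>
      intro h1
      have h2 := (hseq.isSuccPair hχ ht h1).1
      rw [hfirst] at h2 ⊢
      exact hbase _ h2
    | succ i ih =>
      intro hi
      rcases Nat.eq_zero_or_pos i with rfl | hi0
      · refine drawnOrient_succ_pos hd (by omega) hseq.1 hseq.2.1 hg (h := h₂) (h' := h₃)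
          (by tauto) (by tauto) ⟨ht.1.symm, ?_, ?_⟩ ⟨ht.2.2.1, ?_, ?_⟩ (ih (by omega))
        · rw [← hlast]; exact (hentry _ _ (by omega) (by omega)).symm
        · rw [← hlast]; exact (hentry _ _ (by omega) (by omega)).symm
        · rw [← hfirst]; exact hentry _ _ (by omega) (by omega)
        · rw [← hfirst]; exact hentry _ _ (by omega) (by omega)
      · refine drawnOrient_succ_pos hd (by omega) hseq.1 hseq.2.1 hg (h := h₃) (h' := h₃)
          (by tauto) (by tauto) ⟨ht.2.2.1, ?_, ?_⟩ ⟨ht.2.2.1, ?_, ?_⟩ (ih (by omega)) <;>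
        · rw [← hfirst]; exact hentry _ _ (by omega) (by omega)
  by_cases hu : u = h₃
  · subst hu
    exact hbase w huw
  have hw : w ≠ h₃ := by
    rintro rfl
    exact hχ.asymm huw (ht.2.2.2.2.2 u hu (hχ.ne huw).1)
  refine hχ.pos_of_succ (D := fun a b => drawnOrient ε g a h₁ b)
    (drawnOrient_plucker ε g h₁) hbase ?_ (ht.2.2.2.2.2 u hu (hχ.ne huw).1)
    (ht.2.2.2.2.2 w hw (hχ.ne huw).2.2.symm) huw
  intro u w huw
  obtain ⟨i, hi, rfl⟩ := exists_cycEntry_eq (v := h₁) ((hseq.2.1 u).mpr (hχ.ne huw).1)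
  have hi1 : i + 1 < s.length := by
    by_contra hcon
    obtain rfl : i = s.length - 1 := by omega
    rw [hlast] at huw
    have h2 := ht.2.2.2.1 w (hχ.ne huw).2.2.symm (hχ.ne huw).2.1.symm
    rw [hχ.2.2.1, h2] at huw
    omega
  have h1 := hseq.isSuccPair hχ ht hi1
  exact ⟨_, h1.1, hpos i hi1, h1.2⟩

theorem pos_of_internal_center (hχ : IsOrderType χ) (hn : 4 ≤ Fintype.card V) {h₁ h₂ h₃ : V}
    (ht : IsHullTriangle χ h₁ h₂ h₃) {ε : ℝ} {g : V → ℝ × ℝ} (hd : IsDrawnHull ε g h₁ h₂ h₃)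
    (hcorner : ∀ u w, χ u h₁ w = 1 → 0 < drawnOrient ε g u h₁ w) {v : V}
    (hv : v ≠ h₁ ∧ v ≠ h₂ ∧ v ≠ h₃) {s : List V} (hseq : IsInternalSurroundSeq χ v s)
    (hg : IsPlaneDrawing (wheelGraph v s) g) {u w : V} (hu : χ h₁ v u = 1) (hw : χ h₁ v w = 1)
    (huw : χ u v w = 1) : 0 < drawnOrient ε g u v w := by
  have hlen := length_of_enum hseq.1 hseq.2.1
  have hbase : ∀ z, χ h₁ v z = 1 → 0 < drawnOrient ε g h₁ v z := by
    intro z hz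
    rw [← drawnOrient_rotate, ← drawnOrient_rotate]
    exact hcorner _ _ (by rwa [← hχ.rotate])
  have hfree : ∀ a b, ∃ h, (h = h₁ ∨ h = h₂ ∨ h = h₃) ∧ h ≠ v ∧ h ≠ a ∧ h ≠ b := by
    intro a b
    have h12 := ht.1
    have h23 := ht.2.1
    have h31 := ht.2.2.1
    by_contra! hcon
    have c1 := hcon h₁ (Or.inl rfl) hv.1.symm
    have c2 := hcon h₂ (Or.inr (Or.inl rfl)) hv.2.1.symm
    have c3 := hcon h₃ (Or.inr (Or.inr rfl)) hv.2.2.symm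
    rcases eq_or_ne h₁ a with e1 | e1 <;> rcases eq_or_ne h₂ a with e2 | e2 <;> grind
  obtain ⟨k, hk, hk1⟩ := exists_cycEntry_eq (v := v) ((hseq.2.1 h₁).mpr hv.1.symm)
  have hpos : ∀ i, k ≤ i → 0 < drawnOrient ε g (cycEntry v s i) v (cycEntry v s (i + 1)) := by
    intro i hi
    induction i, hi using Nat.le_induction with
    | base =>
      have h2 := (hseq.isSuccPair hχ k).1
      rw [hk1] at h2 ⊢
      exact hbase _ h2
    | succ i hi ih =>
      obtain ⟨h, hh, h0⟩ := hfree (cycEntry v s i) (cycEntry v s (i + 1))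
      obtain ⟨h', hh', h1⟩ := hfree (cycEntry v s (i + 1)) (cycEntry v s (i + 2))
      exact drawnOrient_succ_pos hd (by omega) hseq.1 hseq.2.1 hg hh hh' h0 h1 ih
  refine hχ.pos_of_succ (D := fun a b => drawnOrient ε g a v b)
    (drawnOrient_plucker ε g v) hbase ?_ hu hw huw
  intro u w huw
  obtain ⟨i, hi, rfl⟩ := exists_cycEntry_offset_eq (v := v) k ((hseq.2.1 u).mpr (hχ.ne huw).1)
  have h1 := hseq.isSuccPair hχ (k + i)
  exact ⟨_, h1.1, hpos _ (by omega), h1.2⟩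

/-- Plane drawings of all wheel graphs with the hull triangle outermost determine `χ`. -/
theorem drawnOrient_pos_of_eq_one (hχ : IsOrderType χ) (hn : 4 ≤ Fintype.card V) {h₁ h₂ h₃ : V}
    (ht : IsHullTriangle χ h₁ h₂ h₃) {S : V → List V}
    (hShull : ∀ v ∈ ({h₁, h₂, h₃} : Set V), IsHullSurroundSeq χ v (S v))
    (hSint : ∀ v ∉ ({h₁, h₂, h₃} : Set V), IsInternalSurroundSeq χ v (S v))
    {ε : ℝ} {g : V → ℝ × ℝ} (hd : IsDrawnHull ε g h₁ h₂ h₃)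
    (hg : ∀ v, IsPlaneDrawing (wheelGraph v (S v)) g) {a b c : V} (habc : χ a b c = 1) :
    0 < drawnOrient ε g a b c := by
  have c1 : ∀ u w, χ u h₁ w = 1 → 0 < drawnOrient ε g u h₁ w := fun u w =>
    pos_of_hull_center hχ hn ht hd (hShull h₁ (by simp)) (hg h₁)
  have hcenter : ∀ h, (h = h₁ ∨ h = h₂ ∨ h = h₃) → ∀ u w, χ u h w = 1 →
      0 < drawnOrient ε g u h w := by
    rintro h (rfl | rfl | rfl) u w
    · exact c1 u w
    · exact pos_of_hull_center hχ hn ht.rotate hd.rotate (hShull h (by simp)) (hg h)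
    · exact pos_of_hull_center hχ hn ht.rotate.rotate hd.rotate.rotate (hShull h (by simp)) (hg h)
  by_cases hb : b = h₁ ∨ b = h₂ ∨ b = h₃
  · exact hcenter b hb a c habc
  by_cases ha : a = h₁ ∨ a = h₂ ∨ a = h₃
  · rw [← drawnOrient_rotate, ← drawnOrient_rotate]
    exact hcenter a ha c b (by rwa [← hχ.rotate])
  by_cases hc : c = h₁ ∨ c = h₂ ∨ c = h₃
  · rw [← drawnOrient_rotate]
    exact hcenter c hc b a (by rwa [hχ.rotate])
  have main : ∀ x y z, ¬ (y = h₁ ∨ y = h₂ ∨ y = h₃) → χ x y z = 1 → χ h₁ y z = 1 →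
      χ h₁ y x = 1 → 0 < drawnOrient ε g x y z := by
    intro x y z hy hxyz h1 h2
    push Not at hy
    exact pos_of_internal_center hχ hn ht hd c1 hy
      (hSint y (by simpa [not_or] using hy)) (hg y) h2 h1 hxyz
  have hd' := hχ.ne habc
  have hside : ∀ x y, ¬ (x = h₁ ∨ x = h₂ ∨ x = h₃) → ¬ (y = h₁ ∨ y = h₂ ∨ y = h₃) → x ≠ y →
      χ h₁ x y = 1 ∨ χ h₁ y x = 1 := by
    intro x y hx hy hxy
    push Not at hx hy
    rcases hχ.1 h₁ x y hx.1.symm hy.1.symm hxy with h | h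
    · exact Or.inl h
    · right; rw [hχ.2.2.2.1, h, neg_neg]
  have htrans : ∀ x y z, ¬ (x = h₁ ∨ x = h₂ ∨ x = h₃) → ¬ (y = h₁ ∨ y = h₂ ∨ y = h₃) →
      ¬ (z = h₁ ∨ z = h₂ ∨ z = h₃) → χ h₁ x y = 1 → χ h₁ y z = 1 → χ h₁ z x ≠ 1 := by
    intro x y z hx hy hz hxy hyz hzx
    push Not at hx hy hz
    rw [← hχ.rotate, ← hχ.rotate] at hxy hyz hzx
    have := hχ.trans (ht.2.2.2.2.2 z hz.2.2 hz.1) (ht.2.2.2.2.2 y hy.2.2 hy.1)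
      (ht.2.2.2.2.2 x hx.2.2 hx.1) hyz hxy
    exact hχ.asymm this hzx
  have hbca : χ b c a = 1 := by rwa [hχ.rotate]
  have hcab : χ c a b = 1 := by rwa [hχ.rotate]
  have e1 : drawnOrient ε g b c a = drawnOrient ε g a b c := drawnOrient_rotate ε g a b c
  have e2 : drawnOrient ε g c a b = drawnOrient ε g a b c := by
    rw [drawnOrient_rotate, drawnOrient_rotate]
  rcases hside a b ha hb hd'.1 with hab | hab <;>
    rcases hside b c hb hc hd'.2.2 with hbc | hbc <;>
    rcases hside a c ha hc hd'.2.1 with hac | hac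
  · exact e2 ▸ main c a b ha hcab hab hac
  · exact (htrans a b c ha hb hc hab hbc hac).elim
  · exact e2 ▸ main c a b ha hcab hab hac
  · exact e1 ▸ main b c a hc hbca hac hbc
  · exact main a b c hb habc hbc hab
  · exact main a b c hb habc hbc hab
  · exact (htrans c b a hc hb ha hbc hab hac).elim
  · exact e1 ▸ main b c a hc hbca hac hbc

end DrawnWheels

section Copies

variable {V : Type*} {h₁ h₂ h₃ : V}

/-- The vertex `t_{x+1}` of the frame. -/
def frameVert (h₁ h₂ h₃ : V) (x : Fin 4) : TVert V h₁ h₂ h₃ := Sum.inl x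

/-- The copy with index `i` of the non-hull element `u`. -/
def innerVert {u : V} (hu : u ≠ h₁ ∧ u ≠ h₂ ∧ u ≠ h₃) (i : Fin 3) : TVert V h₁ h₂ h₃ :=
  Sum.inr (⟨u, hu⟩, i)

theorem frameVert_injective : Function.Injective (frameVert h₁ h₂ h₃) := Sum.inl_injective

theorem frameVert_ne_innerVert (x : Fin 4) {u : V} (hu : u ≠ h₁ ∧ u ≠ h₂ ∧ u ≠ h₃) (i : Fin 3) :
    frameVert h₁ h₂ h₃ x ≠ innerVert hu i := Sum.inl_ne_inr

theorem innerVert_inj {u w : V} {hu : u ≠ h₁ ∧ u ≠ h₂ ∧ u ≠ h₃}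
    {hw : w ≠ h₁ ∧ w ≠ h₂ ∧ w ≠ h₃} {i j : Fin 3} (h : innerVert hu i = innerVert hw j) :
    u = w ∧ i = j := by
  have h' := Prod.mk.inj (Sum.inr_injective h)
  exact ⟨congrArg Subtype.val h'.1, h'.2⟩

theorem surround_mem_iff {χ : V → V → V → ℤ} {S : V → List V}
    (hShull : ∀ v ∈ ({h₁, h₂, h₃} : Set V), IsHullSurroundSeq χ v (S v))
    (hSint : ∀ v ∉ ({h₁, h₂, h₃} : Set V), IsInternalSurroundSeq χ v (S v)) (v x : V) :
    x ∈ S v ↔ x ≠ v := by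
  by_cases hv : v ∈ ({h₁, h₂, h₃} : Set V)
  · exact (hShull v hv).2.1 x
  · exact (hSint v hv).2.1 x

theorem isDrawnHull_of_inTriangle {ε : ℝ} {g : V → ℝ × ℝ}
    (h0 : 0 < drawnOrient ε g h₁ h₂ h₃)
    (hin : ∀ v, (v ≠ h₁ ∧ v ≠ h₂ ∧ v ≠ h₃) → InTriangle (g v) (g h₁) (g h₂) (g h₃)) :
    IsDrawnHull ε g h₁ h₂ h₃ := by
  have key : ∀ a b c : V, 0 < drawnOrient ε g a b c →
      (∀ v, (v ≠ a ∧ v ≠ b ∧ v ≠ c) → InTriangle (g v) (g a) (g b) (g c)) →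
      ∀ z, z ≠ a → z ≠ b → 0 < drawnOrient ε g a b z := by
    intro a b c habc h z hza hzb
    by_cases hzc : z = c
    · rwa [hzc]
    · obtain ⟨α, β, γ, -, -, hγ, hs, he⟩ := h z ⟨hza, hzb, hzc⟩
      have : drawnOrient ε g a b z = γ * drawnOrient ε g a b c := by
        simp only [drawnOrient, he, orient_combination hs]
        simp only [orient, det2, Prod.fst_sub, Prod.snd_sub]
        ring
      rw [this]
      exact mul_pos hγ habc
  refine ⟨key _ _ _ h0 hin, key h₂ h₃ h₁ (by rwa [drawnOrient_rotate]) ?_,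
    key h₃ h₁ h₂ (by rwa [drawnOrient_rotate, drawnOrient_rotate]) ?_⟩
  · intro v hv
    exact (hin v ⟨hv.2.2, hv.1, hv.2.1⟩).rotate
  · intro v hv
    exact (hin v ⟨hv.2.1, hv.2.2, hv.1⟩).rotate.rotate

theorem realizes_of_drawnOrient_pos {χ : V → V → V → ℤ} (hχ : IsOrderType χ) {ε : ℝ}
    (hε : ε ≠ 0) {g : V → ℝ × ℝ} (hg : Function.Injective g)
    (hpos : ∀ a b c, χ a b c = 1 → 0 < drawnOrient ε g a b c) :
    Realizes χ (fun v => ((g v).1, ε * (g v).2)) := by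
  have hdet : ∀ a b c, drawnOrient ε g a b c = det2
      (((g c).1, ε * (g c).2) - ((g a).1, ε * (g a).2))
      (((g b).1, ε * (g b).2) - ((g a).1, ε * (g a).2)) := by
    intro a b c
    simp only [drawnOrient, orient, det2, Prod.fst_sub, Prod.snd_sub]
    ring
  refine ⟨fun a b hab => hg ?_, fun a b c hab hac hbc => ?_⟩
  · simp only [Prod.mk.injEq] at hab
    exact Prod.ext hab.1 (mul_left_cancel₀ hε hab.2)
  · rw [← hdet]
    rcases hχ.1 a b c hab hac hbc with h | h
    · rw [h, sign_pos (hpos _ _ _ h)]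
      rfl
    · have h1 : χ c b a = 1 := by rw [hχ.swap_ends, h, neg_neg]
      have h2 := hpos _ _ _ h1
      have h3 : drawnOrient ε g a b c = -drawnOrient ε g c b a := by
        simp only [drawnOrient, orient, det2, Prod.fst_sub, Prod.snd_sub]
        ring
      rw [h, sign_neg (by linarith)]
      rfl

variable [DecidableEq V]

theorem copyMap_of_ne (i : Fin 3) {u : V} (hu : u ≠ h₁ ∧ u ≠ h₂ ∧ u ≠ h₃) :
    copyMap h₁ h₂ h₃ i u = innerVert hu i := dif_pos hu

theorem copyMap_fst (h12 : h₁ ≠ h₂) (i : Fin 3) :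
    copyMap h₁ h₂ h₃ i h₁ = frameVert h₁ h₂ h₃ (Fin.castLE (by norm_num) i) :=
  (dif_neg fun h => h.1 rfl).trans ((if_neg h12).trans (if_pos rfl))

theorem copyMap_snd (i : Fin 3) : copyMap h₁ h₂ h₃ i h₂ = frameVert h₁ h₂ h₃ 3 :=
  (dif_neg fun h => h.2.1 rfl).trans (if_pos rfl)

theorem copyMap_trd (h23 : h₂ ≠ h₃) (h31 : h₃ ≠ h₁) (i : Fin 3) :
    copyMap h₁ h₂ h₃ i h₃ = frameVert h₁ h₂ h₃ (Fin.castLE (by norm_num) (i + 2)) :=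
  (dif_neg fun h => h.2.2 rfl).trans ((if_neg h23.symm).trans (if_neg h31))

theorem castLE_ne_three (i : Fin 3) : Fin.castLE (by norm_num : 3 ≤ 4) i ≠ 3 := by
  revert i; decide

theorem castLE_add_two_ne (i : Fin 3) :
    Fin.castLE (by norm_num : 3 ≤ 4) (i + 2) ≠ Fin.castLE (by norm_num) i := by
  revert i; decide

theorem copyMap_injective (h12 : h₁ ≠ h₂) (h23 : h₂ ≠ h₃) (h31 : h₃ ≠ h₁) (i : Fin 3) :
    Function.Injective (copyMap h₁ h₂ h₃ i) := by
  have e1 := copyMap_fst (h₃ := h₃) h12 i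
  have e2 := copyMap_snd (h₁ := h₁) (h₂ := h₂) (h₃ := h₃) i
  have e3 := copyMap_trd h23 h31 i
  have n12 : copyMap h₁ h₂ h₃ i h₁ ≠ copyMap h₁ h₂ h₃ i h₂ := by
    rw [e1, e2]
    exact frameVert_injective.ne (castLE_ne_three i)
  have n32 : copyMap h₁ h₂ h₃ i h₃ ≠ copyMap h₁ h₂ h₃ i h₂ := by
    rw [e3, e2]
    exact frameVert_injective.ne (castLE_ne_three (i + 2))
  have n31 : copyMap h₁ h₂ h₃ i h₃ ≠ copyMap h₁ h₂ h₃ i h₁ := by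
    rw [e3, e1]
    exact frameVert_injective.ne (castLE_add_two_ne i)
  have hframe : ∀ a, (a = h₁ ∨ a = h₂ ∨ a = h₃) → ∀ b, (b ≠ h₁ ∧ b ≠ h₂ ∧ b ≠ h₃) →
      copyMap h₁ h₂ h₃ i a ≠ copyMap h₁ h₂ h₃ i b := by
    intro a ha b hb
    rw [copyMap_of_ne i hb]
    rcases ha with rfl | rfl | rfl
    · exact e1 ▸ frameVert_ne_innerVert _ hb i
    · exact e2 ▸ frameVert_ne_innerVert _ hb i
    · exact e3 ▸ frameVert_ne_innerVert _ hb i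
  intro a b hab
  by_cases ha : a ≠ h₁ ∧ a ≠ h₂ ∧ a ≠ h₃ <;> by_cases hb : b ≠ h₁ ∧ b ≠ h₂ ∧ b ≠ h₃
  · rw [copyMap_of_ne i ha, copyMap_of_ne i hb] at hab
    exact (innerVert_inj hab).1
  · exact (hframe b (by tauto) a ha hab.symm).elim
  · exact (hframe a (by tauto) b hb hab).elim
  · have ha' : a = h₁ ∨ a = h₂ ∨ a = h₃ := by tauto
    have hb' : b = h₁ ∨ b = h₂ ∨ b = h₃ := by tauto
    rcases ha' with rfl | rfl | rfl <;> rcases hb' with rfl | rfl | rfl <;>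
      first
      | rfl
      | exact (n12 hab).elim
      | exact (n12 hab.symm).elim
      | exact (n32 hab).elim
      | exact (n32 hab.symm).elim
      | exact (n31 hab).elim
      | exact (n31 hab.symm).elim

theorem TGraph_adj_frame (v : V) (s : List V) {x y : Fin 4} (hxy : x ≠ y) :
    (TGraph h₁ h₂ h₃ v s).Adj (frameVert h₁ h₂ h₃ x) (frameVert h₁ h₂ h₃ y) := by
  rw [TGraph, SimpleGraph.fromRel_adj]
  exact ⟨frameVert_injective.ne hxy, Or.inl (Or.inl ⟨x, y, rfl, rfl⟩)⟩

theorem TGraph_adj_copy (h12 : h₁ ≠ h₂) (h23 : h₂ ≠ h₃) (h31 : h₃ ≠ h₁) (i : Fin 3) {v : V}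
    {s : List V} {a b : V} (hab : (wheelGraph v s).Adj a b) :
    (TGraph h₁ h₂ h₃ v s).Adj (copyMap h₁ h₂ h₃ i a) (copyMap h₁ h₂ h₃ i b) := by
  rw [TGraph, SimpleGraph.fromRel_adj]
  exact ⟨(copyMap_injective h12 h23 h31 i).ne hab.ne,
    Or.inl (Or.inr ⟨i, a, b, hab, rfl, rfl⟩)⟩

/-- In a simultaneous embedding, some copy lies inside its frame triangle. -/
theorem exists_copy_inTriangle (h12 : h₁ ≠ h₂) (h23 : h₂ ≠ h₃) (h31 : h₃ ≠ h₁) {S : V → List V}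
    (hmem : ∀ v x, x ∈ S v ↔ x ≠ v) {φ : TVert V h₁ h₂ h₃ → ℝ × ℝ}
    (hφ : ∀ v, IsPlaneDrawing (TGraph h₁ h₂ h₃ v (S v)) φ) :
    ∃ i : Fin 3, ∀ v, (v ≠ h₁ ∧ v ≠ h₂ ∧ v ≠ h₃) →
      InTriangle (φ (copyMap h₁ h₂ h₃ i v)) (φ (copyMap h₁ h₂ h₃ i h₁))
        (φ (copyMap h₁ h₂ h₃ i h₂)) (φ (copyMap h₁ h₂ h₃ i h₃)) := by
  have key : ∀ (i : Fin 3) (a b c : V) (p q r d : Fin 4),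
      (a = h₁ ∨ a = h₂ ∨ a = h₃) → (b = h₁ ∨ b = h₂ ∨ b = h₃) → (c = h₁ ∨ c = h₂ ∨ c = h₃) →
      copyMap h₁ h₂ h₃ i a = frameVert h₁ h₂ h₃ p → copyMap h₁ h₂ h₃ i b = frameVert h₁ h₂ h₃ q →
      copyMap h₁ h₂ h₃ i c = frameVert h₁ h₂ h₃ r →
      (p ≠ q ∧ p ≠ r ∧ p ≠ d ∧ q ≠ r ∧ q ≠ d ∧ r ≠ d) →
      InTriangle (φ (frameVert h₁ h₂ h₃ p)) (φ (frameVert h₁ h₂ h₃ q)) (φ (frameVert h₁ h₂ h₃ r)) (φ (frameVert h₁ h₂ h₃ d)) →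
      ∀ v, (v ≠ h₁ ∧ v ≠ h₂ ∧ v ≠ h₃) → InTriangle (φ (copyMap h₁ h₂ h₃ i v))
        (φ (frameVert h₁ h₂ h₃ p)) (φ (frameVert h₁ h₂ h₃ q)) (φ (frameVert h₁ h₂ h₃ r)) := by
    intro i a b c p q r d ha hb hc ep eq er hne hin v hv
    have hadj : ∀ h, (h = h₁ ∨ h = h₂ ∨ h = h₃) → (TGraph h₁ h₂ h₃ v (S v)).Adj
        (copyMap h₁ h₂ h₃ i v) (copyMap h₁ h₂ h₃ i h) := fun h hh =>
      TGraph_adj_copy h12 h23 h31 i (wheelGraph_adj_hub (hmem v) (by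
        rintro rfl
        tauto))
    have hvp := hadj a ha
    have hvq := hadj b hb
    have hvr := hadj c hc
    rw [ep] at hvp
    rw [eq] at hvq
    rw [er] at hvr
    refine (hφ v).inTriangle_of_adj_three (d := frameVert h₁ h₂ h₃ d) (TGraph_adj_frame _ _ hne.1)
      (TGraph_adj_frame _ _ hne.2.1) (TGraph_adj_frame _ _ hne.2.2.1)
      (TGraph_adj_frame _ _ hne.2.2.2.1) (TGraph_adj_frame _ _ hne.2.2.2.2.1)
      (TGraph_adj_frame _ _ hne.2.2.2.2.2) hvp hvq hvr ?_ hin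
    rw [copyMap_of_ne i hv]
    exact (frameVert_ne_innerVert _ hv i).symm
  have e1 := fun i => copyMap_fst (h₃ := h₃) h12 i
  have e2 := fun i => copyMap_snd (h₁ := h₁) (h₂ := h₂) (h₃ := h₃) i
  have e3 := fun i => copyMap_trd h23 h31 i
  have hadj : ∀ x y : Fin 4, x ≠ y → _ := fun x y hxy =>
    TGraph_adj_frame (h₁ := h₁) (h₂ := h₂) (h₃ := h₃) h₁ (S h₁) hxy
  rcases (hφ h₁).exists_inTriangle (hadj 0 1 (by decide)) (hadj 0 2 (by decide))
    (hadj 0 3 (by decide)) (hadj 1 2 (by decide)) (hadj 1 3 (by decide)) (hadj 2 3 (by decide))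
    with h | h | h | h
  · refine ⟨0, fun v hv => ?_⟩
    rw [e1, e2, e3]
    exact key 0 h₁ h₂ h₃ 0 3 2 1 (by simp) (by simp) (by simp) (e1 0) (e2 0) (e3 0) (by decide)
      h.swap.rotate.rotate v hv
  · refine ⟨1, fun v hv => ?_⟩
    rw [e1, e2, e3]
    exact key 1 h₁ h₂ h₃ 1 3 0 2 (by simp) (by simp) (by simp) (e1 1) (e2 1) (e3 1) (by decide)
      h.rotate.rotate v hv
  · refine ⟨2, fun v hv => ?_⟩
    rw [e1, e2, e3]
    exact key 2 h₁ h₂ h₃ 2 3 1 0 (by simp) (by simp) (by simp) (e1 2) (e2 2) (e3 2) (by decide)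
      h.swap.rotate.rotate v hv
  · refine ⟨0, fun v hv => ?_⟩
    rw [e1, e2, e3]
    exact (key 0 h₂ h₁ h₃ 3 0 2 1 (by simp) (by simp) (by simp) (e2 0) (e1 0) (e3 0) (by decide)
      h.swap.rotate v hv).swap

theorem exists_realizes_of_isPlaneDrawing [Fintype V] {χ : V → V → V → ℤ}
    (hn : 4 ≤ Fintype.card V) (hχ : IsOrderType χ) (ht : IsHullTriangle χ h₁ h₂ h₃)
    {S : V → List V}
    (hShull : ∀ v ∈ ({h₁, h₂, h₃} : Set V), IsHullSurroundSeq χ v (S v))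
    (hSint : ∀ v ∉ ({h₁, h₂, h₃} : Set V), IsInternalSurroundSeq χ v (S v))
    {φ : TVert V h₁ h₂ h₃ → ℝ × ℝ} (hφ : ∀ v, IsPlaneDrawing (TGraph h₁ h₂ h₃ v (S v)) φ) :
    ∃ f, Realizes χ f := by
  have hmem := surround_mem_iff hShull hSint
  have h12 := ht.1
  have h23 := ht.2.1
  have h31 := ht.2.2.1
  obtain ⟨i, hi⟩ := exists_copy_inTriangle h12 h23 h31 hmem hφ
  have hinj := copyMap_injective h12 h23 h31 i
  have hg : ∀ v, IsPlaneDrawing (wheelGraph v (S v)) (φ ∘ copyMap h₁ h₂ h₃ i) := fun v =>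
    (hφ v).comp hinj fun a b hab => TGraph_adj_copy h12 h23 h31 i hab
  set g := φ ∘ copyMap h₁ h₂ h₃ i with hgdef
  have hne : orient (g h₁) (g h₂) (g h₃) ≠ 0 := by
    have hadj : ∀ x y : V, ∀ p q : Fin 4, copyMap h₁ h₂ h₃ i x = frameVert h₁ h₂ h₃ p →
        copyMap h₁ h₂ h₃ i y = frameVert h₁ h₂ h₃ q → x ≠ y → (TGraph h₁ h₂ h₃ h₁ (S h₁)).Adj
          (copyMap h₁ h₂ h₃ i x) (copyMap h₁ h₂ h₃ i y) := by
      intro x y p q hp hq hxy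
      have hne := hinj.ne hxy
      rw [hp, hq] at hne ⊢
      exact TGraph_adj_frame _ _ fun h => hne (by rw [h])
    exact (hφ h₁).orient_ne_zero
      (hadj _ _ _ _ (copyMap_fst h12 i) (copyMap_snd i) h12)
      (hadj _ _ _ _ (copyMap_snd i) (copyMap_trd h23 h31 i) h23)
      (hadj _ _ _ _ (copyMap_fst h12 i) (copyMap_trd h23 h31 i) h31.symm)
  have h0 : 0 < drawnOrient (orient (g h₁) (g h₂) (g h₃)) g h₁ h₂ h₃ :=
    mul_self_pos.mpr hne
  have hd := isDrawnHull_of_inTriangle h0 hi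
  exact ⟨_, realizes_of_drawnOrient_pos hχ hne (hg h₁).1 fun a b c habc =>
    drawnOrient_pos_of_eq_one hχ hn ht hShull hSint hd hg habc⟩

end Copies

section OpenSegments

theorem eq_or_eq_or_mem_openSegment {a b z : ℝ × ℝ} (hz : z ∈ segment ℝ a b) :
    z = a ∨ z = b ∨ z ∈ openSegment ℝ a b := by
  rw [← insert_endpoints_openSegment] at hz
  exact hz

/-- Planarity of a drawing only has to be checked on the relative interiors of the edges. -/
theorem isPlaneDrawing_of_openSegment {U : Type*} {G : SimpleGraph U} {φ : U → ℝ × ℝ}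
    (hinj : Function.Injective φ)
    (hvert : ∀ a b x, G.Adj a b → φ x ∉ openSegment ℝ (φ a) (φ b))
    (hcross : ∀ a b c d, G.Adj a b → G.Adj c d → s(a, b) ≠ s(c, d) →
      ∀ z, z ∈ openSegment ℝ (φ a) (φ b) → z ∉ openSegment ℝ (φ c) (φ d)) :
    IsPlaneDrawing G φ := by
  have hclosed : ∀ a b x, G.Adj a b → φ x ∈ segment ℝ (φ a) (φ b) → x = a ∨ x = b := by
    intro a b x hab hx
    rcases eq_or_eq_or_mem_openSegment hx with h | h | h
    · exact Or.inl (hinj h)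
    · exact Or.inr (hinj h)
    · exact (hvert a b x hab h).elim
  refine ⟨hinj, fun a b c d hab hcd hne => ?_, fun a b x hab hxa hxb hx =>
    (hclosed a b x hab hx).elim hxa hxb⟩
  ext z
  constructor
  · rintro ⟨hz, hz'⟩
    have hmem : ∀ x, φ x = z → z ∈ φ '' (({a, b} : Set U) ∩ {c, d}) := by
      rintro x rfl
      exact ⟨x, ⟨hclosed a b x hab hz, hclosed c d x hcd hz'⟩, rfl⟩
    rcases eq_or_eq_or_mem_openSegment hz with h | h | h
    · exact hmem a h.symm
    · exact hmem b h.symm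
    rcases eq_or_eq_or_mem_openSegment hz' with h' | h' | h'
    · exact hmem c h'.symm
    · exact hmem d h'.symm
    exact (hcross a b c d hab hcd hne z h h').elim
  · rintro ⟨x, ⟨hx, hx'⟩, rfl⟩
    constructor
    · rcases hx with rfl | rfl
      · exact left_mem_segment ℝ _ _
      · exact right_mem_segment ℝ _ _
    · rcases hx' with rfl | rfl
      · exact left_mem_segment ℝ _ _
      · exact right_mem_segment ℝ _ _

theorem orient_eq_zero_of_mem_openSegment {a b z : ℝ × ℝ} (hz : z ∈ openSegment ℝ a b) :
    orient a z b = 0 := by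
  obtain ⟨s, t, hs, ht, hst, rfl⟩ := hz
  obtain rfl : s = 1 - t := by linarith
  simp only [orient, det2, Prod.fst_sub, Prod.snd_sub, Prod.fst_add, Prod.snd_add,
    Prod.smul_fst, Prod.smul_snd, smul_eq_mul]
  ring

theorem orient_eq_zero_of_mem_openSegments {a b d z : ℝ × ℝ} (hz : z ∈ openSegment ℝ a b)
    (hz' : z ∈ openSegment ℝ a d) : orient a b d = 0 := by
  obtain ⟨s, t, hs, ht, hst, rfl⟩ := hz
  obtain ⟨p, q, hp, hq, hpq, he⟩ := hz'
  obtain rfl : s = 1 - t := by linarith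
  obtain rfl : p = 1 - q := by linarith
  have e1 := congrArg Prod.fst he
  have e2 := congrArg Prod.snd he
  simp only [Prod.fst_add, Prod.snd_add, Prod.smul_fst, Prod.smul_snd, smul_eq_mul] at e1 e2
  have : t * orient a b d = 0 := by
    simp only [orient, det2, Prod.fst_sub, Prod.snd_sub]
    linear_combination (d.2 - a.2) * e1 - (d.1 - a.1) * e2
  exact (mul_eq_zero.mp this).resolve_left ht.ne'

/-- A point on the open edge `a b` lies strictly between `a` and `b` as seen from `v`. -/
theorem orient_pos_of_mem_openSegment {v a b z : ℝ × ℝ} (h : 0 < orient a v b)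
    (hz : z ∈ openSegment ℝ a b) : 0 < orient a v z ∧ 0 < orient z v b := by
  obtain ⟨s, t, hs, ht, hst, rfl⟩ := hz
  obtain rfl : s = 1 - t := by linarith
  have e1 : orient a v ((1 - t) • a + t • b) = t * orient a v b := by
    simp only [orient, det2, Prod.fst_sub, Prod.snd_sub, Prod.fst_add, Prod.snd_add,
      Prod.smul_fst, Prod.smul_snd, smul_eq_mul]
    ring
  have e2 : orient ((1 - t) • a + t • b) v b = (1 - t) * orient a v b := by
    simp only [orient, det2, Prod.fst_sub, Prod.snd_sub, Prod.fst_add, Prod.snd_add,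
      Prod.smul_fst, Prod.smul_snd, smul_eq_mul]
    ring
  rw [e1, e2]
  exact ⟨mul_pos ht h, mul_pos hs h⟩

/-- Points on the open spoke `v u` are seen from `v` in the direction of `u`. -/
theorem orient_spoke {v u z : ℝ × ℝ} (hz : z ∈ openSegment ℝ v u) :
    ∃ t > 0, ∀ a, orient a v z = t * orient a v u ∧ orient z v a = t * orient u v a := by
  obtain ⟨s, t, hs, ht, hst, rfl⟩ := hz
  obtain rfl : s = 1 - t := by linarith
  refine ⟨t, ht, fun a => ⟨?_, ?_⟩⟩ <;>
  · simp only [orient, det2, Prod.fst_sub, Prod.snd_sub, Prod.fst_add, Prod.snd_add,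
      Prod.smul_fst, Prod.smul_snd, smul_eq_mul]
    ring

end OpenSegments

section RealizedWheels

variable {V : Type*} {χ : V → V → V → ℤ} {g : V → ℝ × ℝ}

/-- The drawing `g` has clockwise triples wherever `χ` is positive. -/
def IsOrientedBy (χ : V → V → V → ℤ) (g : V → ℝ × ℝ) : Prop :=
  ∀ a b c, χ a b c = 1 → 0 < orient (g a) (g b) (g c)

theorem Realizes.isOrientedBy (hχ : IsOrderType χ) (h : Realizes χ g) : IsOrientedBy χ g := by
  intro a b c habc
  have hne := hχ.ne habc
  have h1 := h.2 a b c hne.1 hne.2.1 hne.2.2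
  rw [habc] at h1
  have h2 : SignType.sign (orient (g a) (g b) (g c)) = 1 := by
    rw [orient]
    revert h1
    generalize SignType.sign (det2 (g c - g a) (g b - g a)) = σ
    revert σ
    decide
  exact sign_eq_one_iff.mp h2

theorem IsOrientedBy.eq_one (hg : IsOrientedBy χ g) (hχ : IsOrderType χ) {a b c : V}
    (hab : a ≠ b) (hac : a ≠ c) (hbc : b ≠ c) (h : 0 < orient (g a) (g b) (g c)) :
    χ a b c = 1 := by
  by_contra hne
  have h1 := hg _ _ _ (hχ.eq_one_of_ne hab hac hbc hne)
  rw [orient_swap_left, orient_rotate] at h1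
  linarith

theorem IsOrientedBy.orient_ne_zero (hg : IsOrientedBy χ g) (hχ : IsOrderType χ) {a b c : V}
    (hab : a ≠ b) (hac : a ≠ c) (hbc : b ≠ c) : orient (g a) (g b) (g c) ≠ 0 := by
  intro h0
  by_cases h : χ a b c = 1
  · exact (hg _ _ _ h).ne' h0
  · have h1 := hg _ _ _ (hχ.eq_one_of_ne hab hac hbc h)
    rw [orient_swap_left, orient_rotate, h0] at h1
    simp at h1

theorem IsOrientedBy.injective (hg : IsOrientedBy χ g) (hχ : IsOrderType χ) [Fintype V]
    (hn : 4 ≤ Fintype.card V) : Function.Injective g := by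
  classical
  intro a b hab
  by_contra hne
  obtain ⟨c, hc⟩ : ∃ c, c ∉ ({a, b} : Finset V) := by
    by_contra! hcon
    have h1 := Finset.card_le_card (fun x _ => hcon x : Finset.univ ⊆ ({a, b} : Finset V))
    have h2 := Finset.card_le_two (a := a) (b := b)
    rw [Finset.card_univ] at h1
    omega
  simp only [Finset.mem_insert, Finset.mem_singleton, not_or] at hc
  refine hg.orient_ne_zero hχ hne (Ne.symm hc.1) (Ne.symm hc.2) ?_
  simp [orient, det2, hab]

theorem IsOrientedBy.notMem_openSegment (hg : IsOrientedBy χ g) (hχ : IsOrderType χ)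
    (hinj : Function.Injective g) {a b : V} (hab : a ≠ b) (x : V) :
    g x ∉ openSegment ℝ (g a) (g b) := by
  intro hx
  by_cases hxa : x = a
  · rw [hxa, left_mem_openSegment_iff] at hx
    exact hab (hinj hx)
  by_cases hxb : x = b
  · rw [hxb, right_mem_openSegment_iff] at hx
    exact hab (hinj hx)
  exact hg.orient_ne_zero hχ (Ne.symm hxa) hab hxb (orient_eq_zero_of_mem_openSegment hx)

theorem IsOrientedBy.not_crossing_spoke (hg : IsOrientedBy χ g) (hχ : IsOrderType χ)
    {v u a b : V} (huv : u ≠ v) (hua : u ≠ a) (hub : u ≠ b) (h : IsSuccPair χ v a b)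
    {z : ℝ × ℝ} (hz : z ∈ openSegment ℝ (g v) (g u)) :
    z ∉ openSegment ℝ (g a) (g b) := by
  intro hz'
  have hne := hχ.ne h.1
  obtain ⟨t, ht, hspoke⟩ := orient_spoke hz
  obtain ⟨h1, h2⟩ := orient_pos_of_mem_openSegment (hg _ _ _ h.1) hz'
  rw [(hspoke _).1] at h1
  rw [(hspoke _).2] at h2
  exact h.2 u ⟨hg.eq_one hχ hne.1 hua.symm huv.symm (pos_of_mul_pos_right h1 ht.le),
    hg.eq_one hχ huv hub hne.2.2 (pos_of_mul_pos_right h2 ht.le)⟩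

theorem IsOrientedBy.not_crossing_rim (hg : IsOrientedBy χ g) (hχ : IsOrderType χ)
    {v a b c d : V} (hac : a ≠ c) (had : a ≠ d) (hbc : b ≠ c)
    (h : IsSuccPair χ v a b) (h' : IsSuccPair χ v c d) {z : ℝ × ℝ}
    (hz : z ∈ openSegment ℝ (g a) (g b)) : z ∉ openSegment ℝ (g c) (g d) := by
  intro hz'
  have key : ∀ a b c d : V, b ≠ c → IsSuccPair χ v a b → IsSuccPair χ v c d →
      z ∈ openSegment ℝ (g a) (g b) → z ∈ openSegment ℝ (g c) (g d) → χ a v c = 1 → False := by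
    intro a b c d hbc h h' hz hz' hac
    have hv := hχ.ne h.1
    have hv' := hχ.ne h'.1
    obtain ⟨h1, h2⟩ := orient_pos_of_mem_openSegment (hg _ _ _ h.1) hz
    obtain ⟨h3, -⟩ := orient_pos_of_mem_openSegment (hg _ _ _ h'.1) hz'
    have h4 := hg _ _ _ (hχ.eq_one_of_ne hv'.1 hbc.symm hv.2.2 fun hcb => h.2 c ⟨hac, hcb⟩)
    have h5 := hg _ _ _ h.1
    have h6 := hg _ _ _ hac
    have hpl := orient_plucker (g v) (g a) z (g b) (g c)
    have m1 := mul_pos h1 h4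
    have m2 := mul_pos h6 h2
    have m3 := mul_pos h5 h3
    have e : orient z (g v) (g c) = -orient (g c) (g v) z := by
      rw [orient_swap_left, orient_rotate]
    rw [e] at hpl
    linarith
  have hv := hχ.ne h.1
  have hv' := hχ.ne h'.1
  by_cases h1 : χ a v c = 1
  · exact key a b c d hbc h h' hz hz' h1
  · exact key c d a b had.symm h' h hz' hz (hχ.eq_one_of_ne hv.1 hac hv'.1.symm h1)

/-- Spokes of the wheel with hub `v`, and pairs of elements consecutive around `v`. -/
def IsWheelEdge (χ : V → V → V → ℤ) (v a b : V) : Prop :=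
  a = v ∨ b = v ∨ IsSuccPair χ v a b ∨ IsSuccPair χ v b a

theorem IsOrientedBy.not_crossing (hg : IsOrientedBy χ g) (hχ : IsOrderType χ)
    {v a b c d : V} (hab : a ≠ b) (hcd : c ≠ d) (h : IsWheelEdge χ v a b)
    (h' : IsWheelEdge χ v c d) (hne : s(a, b) ≠ s(c, d)) {z : ℝ × ℝ}
    (hz : z ∈ openSegment ℝ (g a) (g b)) : z ∉ openSegment ℝ (g c) (g d) := by
  intro hz'
  have hshare : ∀ a b d, a ≠ b → a ≠ d → z ∈ openSegment ℝ (g a) (g b) →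
      z ∈ openSegment ℝ (g a) (g d) → b = d := by
    intro a b d hab had hz hz'
    by_contra hbd
    exact hg.orient_ne_zero hχ hab had hbd (orient_eq_zero_of_mem_openSegments hz hz')
  have hz1 := openSegment_symm ℝ (g a) (g b) ▸ hz
  have hz1' := openSegment_symm ℝ (g c) (g d) ▸ hz'
  have hac : a ≠ c := by
    rintro rfl
    exact hne (by rw [hshare a b d hab hcd hz hz'])
  have had : a ≠ d := by
    rintro rfl
    exact hne (by rw [hshare a b c hab hcd.symm hz hz1', Sym2.eq_swap])
  have hbc : b ≠ c := by
    rintro rfl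
    exact hne (by rw [hshare b a d hab.symm hcd hz1 hz', Sym2.eq_swap])
  have hbd : b ≠ d := by
    rintro rfl
    exact hne (by rw [hshare b a c hab.symm hcd.symm hz1 hz1'])
  have key : ∀ a b c d : V, a ≠ b → c ≠ d → a ≠ c → a ≠ d → b ≠ c → b ≠ d →
      z ∈ openSegment ℝ (g a) (g b) → z ∈ openSegment ℝ (g c) (g d) →
      (a = v ∨ IsSuccPair χ v a b) → (c = v ∨ IsSuccPair χ v c d) → False := by
    rintro a b c d hab hcd hac had hbc hbd hz hz' (rfl | h) (rfl | h')
    · exact hac rfl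
    · exact hg.not_crossing_spoke hχ hab.symm hbc hbd h' hz hz'
    · exact hg.not_crossing_spoke hχ hcd.symm had.symm hbd.symm h hz' hz
    · exact hg.not_crossing_rim hχ hac had hbc h h' hz hz'
  have h1 : (a = v ∨ IsSuccPair χ v a b) ∨ (b = v ∨ IsSuccPair χ v b a) := by
    rcases h with h | h | h | h <;> tauto
  have h2 : (c = v ∨ IsSuccPair χ v c d) ∨ (d = v ∨ IsSuccPair χ v d c) := by
    rcases h' with h | h | h | h <;> tauto
  rcases h1 with h1 | h1 <;> rcases h2 with h2 | h2
  · exact key a b c d hab hcd hac had hbc hbd hz hz' h1 h2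
  · exact key a b d c hab hcd.symm had hac hbd hbc hz hz1' h1 h2
  · exact key b a c d hab.symm hcd hbc hbd hac had hz1 hz' h1 h2
  · exact key b a d c hab.symm hcd.symm hbd hbc had hac hz1 hz1' h1 h2

/-- Every wheel edge other than a hull edge is a spoke or joins consecutive elements. -/
theorem isWheelEdge_of_adj (hχ : IsOrderType χ) [Fintype V] (hn : 4 ≤ Fintype.card V)
    {h₁ h₂ h₃ : V} (ht : IsHullTriangle χ h₁ h₂ h₃) {v : V} {s : List V}
    (hShull : v ∈ ({h₁, h₂, h₃} : Set V) → IsHullSurroundSeq χ v s)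
    (hSint : v ∉ ({h₁, h₂, h₃} : Set V) → IsInternalSurroundSeq χ v s) {a b : V}
    (hab : (wheelGraph v s).Adj a b)
    (hnh : (a ≠ h₁ ∧ a ≠ h₂ ∧ a ≠ h₃) ∨ (b ≠ h₁ ∧ b ≠ h₂ ∧ b ≠ h₃)) :
    IsWheelEdge χ v a b := by
  by_cases hv : v ∈ ({h₁, h₂, h₃} : Set V)
  · have hS := hShull hv
    have hlen := length_of_enum hS.1 hS.2.1
    have key : ∀ p q, IsHullTriangle χ v p q → (p = h₁ ∨ p = h₂ ∨ p = h₃) →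
        (q = h₁ ∨ q = h₂ ∨ q = h₃) → IsWheelEdge χ v a b := by
      intro p q hpq hp hq
      rcases wheelGraph_adj_cases (by omega) hab with h | h | ⟨i, hi, hi'⟩
      · exact Or.inl h
      · exact Or.inr (Or.inl h)
      · by_cases hlast : i + 1 < s.length
        · have hsucc := hS.isSuccPair hχ hpq hlast
          rcases hi' with ⟨rfl, rfl⟩ | ⟨rfl, rfl⟩
          · exact Or.inr (Or.inr (Or.inl hsucc))
          · exact Or.inr (Or.inr (Or.inr hsucc))
        · obtain rfl : i = s.length - 1 := by omega
          have e1 := hS.entry_last hχ hpq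
          have e2 := hS.entry_zero hχ hpq
          have e3 : cycEntry v s (s.length - 1 + 1) = q := by
            rw [Nat.sub_add_cancel (by omega), ← cycEntry_mod, Nat.mod_self, e2]
          rw [e1, e3] at hi'
          rcases hi' with ⟨rfl, rfl⟩ | ⟨rfl, rfl⟩ <;> tauto
    rcases hv with rfl | rfl | rfl
    · exact key _ _ ht (by tauto) (by tauto)
    · exact key _ _ ht.rotate (by tauto) (by tauto)
    · exact key _ _ ht.rotate.rotate (by tauto) (by tauto)
  · have hS := hSint hv
    have hlen := length_of_enum hS.1 hS.2.1
    rcases wheelGraph_adj_cases (by omega) hab with h | h | ⟨i, hi, hi'⟩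
    · exact Or.inl h
    · exact Or.inr (Or.inl h)
    · have hsucc := hS.isSuccPair hχ i
      rcases hi' with ⟨rfl, rfl⟩ | ⟨rfl, rfl⟩
      · exact Or.inr (Or.inr (Or.inl hsucc))
      · exact Or.inr (Or.inr (Or.inr hsucc))

/-- The open standard triangle. -/
def stdTriangle : Set (ℝ × ℝ) := {p | 0 < p.1 ∧ 0 < p.2 ∧ p.1 + p.2 < 1}

/-- A realization can be moved affinely so that the hull is the standard triangle. -/
theorem exists_isOrientedBy_std {h₁ h₂ h₃ : V}
    (ht : IsHullTriangle χ h₁ h₂ h₃) {f : V → ℝ × ℝ} (hf : IsOrientedBy χ f) :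
    ∃ g : V → ℝ × ℝ, IsOrientedBy χ g ∧ g h₁ = (1, 0) ∧ g h₂ = (0, 0) ∧ g h₃ = (0, 1) ∧
      ∀ v, (v ≠ h₁ ∧ v ≠ h₂ ∧ v ≠ h₃) → g v ∈ stdTriangle := by
  set A := f h₁ with hA
  set B := f h₂ with hB
  set C := f h₃ with hC
  have hD : 0 < orient A B C := hf _ _ _ (ht.2.2.2.1 h₃ ht.2.2.1 ht.2.1.symm)
  have haff : ∀ p q r : ℝ × ℝ,
      orient (orient p B C / orient A B C, orient A B p / orient A B C)
        (orient q B C / orient A B C, orient A B q / orient A B C)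
        (orient r B C / orient A B C, orient A B r / orient A B C) =
      orient p q r / orient A B C := by
    intro p q r
    have h1 : ∀ D : ℝ, D ≠ 0 → D = orient A B C →
      orient (orient p B C / D, orient A B p / D)
        (orient q B C / D, orient A B q / D)
        (orient r B C / D, orient A B r / D) =
      orient p q r / D := by
      intro D h0 hDD
      have h2 : orient (orient p B C / D, orient A B p / D)
        (orient q B C / D, orient A B q / D)
        (orient r B C / D, orient A B r / D) = orient A B C * orient p q r / D ^ 2 := by
        simp only [orient, det2, Prod.fst_sub, Prod.snd_sub]
        field_simp
        ring
      rw [h2, ← hDD]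
      field_simp
    exact h1 _ hD.ne' rfl
  refine ⟨fun u => (orient (f u) B C / orient A B C, orient A B (f u) / orient A B C),
    fun a b c habc => ?_, ?_, ?_, ?_, fun v hv => ⟨?_, ?_, ?_⟩⟩
  · rw [haff]
    exact div_pos (hf _ _ _ habc) hD
  · have : orient A B A = 0 := by simp [orient, det2]
    simp [← hA, this, hD.ne']
  · have h1 : orient B B C = 0 := by simp [orient, det2]
    have h2 : orient A B B = 0 := by simp [orient, det2, mul_comm]
    simp [← hB, h1, h2]
  · have : orient C B C = 0 := by simp [orient, det2]
    simp [← hC, this, hD.ne']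
  · have := hf _ _ _ (ht.2.2.2.2.1 v hv.2.1 hv.2.2)
    rw [orient_rotate] at this
    exact div_pos this hD
  · exact div_pos (hf _ _ _ (ht.2.2.2.1 v hv.1 hv.2.1)) hD
  · have := hf _ _ _ (ht.2.2.2.2.2 v hv.2.2 hv.1)
    have e : orient A B C - (orient (f v) B C + orient A B (f v)) = orient C A (f v) := by
      simp only [orient, det2, Prod.fst_sub, Prod.snd_sub]
      ring
    change orient (f v) B C / orient A B C + orient A B (f v) / orient A B C < 1
    rw [← add_div, div_lt_one hD]
    linarith

end RealizedWheels

section Faces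

/-- The positions of the frame vertices. -/
def framePos : Fin 4 → ℝ × ℝ := ![(1, 0), (0, 1), (-1, -1), (0, 0)]

/-- The linear map taking the standard triangle to the face of the frame with index `i`. -/
def faceMap (i : Fin 3) (p : ℝ × ℝ) : ℝ × ℝ :=
  p.1 • framePos (Fin.castLE (by norm_num) i) + p.2 • framePos (Fin.castLE (by norm_num) (i + 2))

theorem faceMap_zero (p : ℝ × ℝ) : faceMap 0 p = (p.1 - p.2, -p.2) := by
  simp [faceMap, framePos, sub_eq_add_neg]

theorem faceMap_one (p : ℝ × ℝ) : faceMap 1 p = (p.2, p.1) := by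
  have h1 : (Fin.castLE (by norm_num : 3 ≤ 4) (1 : Fin 3)) = 1 := rfl
  simp [faceMap, framePos, h1]

theorem faceMap_two (p : ℝ × ℝ) : faceMap 2 p = (-p.1, p.2 - p.1) := by
  have h1 : (Fin.castLE (by norm_num : 3 ≤ 4) (2 : Fin 3)) = 2 := rfl
  simp [faceMap, framePos, h1, sub_eq_add_neg, add_comm]

theorem faceMap_injective (i : Fin 3) : Function.Injective (faceMap i) := by
  intro p q h
  fin_cases i <;>
  · simp only [Fin.zero_eta, Fin.mk_one, Fin.reduceFinMk, faceMap_zero, faceMap_one, faceMap_two,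
      Prod.mk.injEq] at h
    exact Prod.ext (by linarith) (by linarith)

theorem eq_of_faceMap_eq {i j : Fin 3} {p q : ℝ × ℝ} (hp : p ∈ stdTriangle) (hq : q ∈ stdTriangle)
    (h : faceMap i p = faceMap j q) : i = j ∧ p = q := by
  have hij : i = j := by
    obtain ⟨p1, p2, -⟩ := hp
    obtain ⟨q1, q2, -⟩ := hq
    fin_cases i <;> fin_cases j <;>
    first
    | rfl
    | exfalso
      simp only [Fin.zero_eta, Fin.mk_one, Fin.reduceFinMk, faceMap_zero, faceMap_one, faceMap_two,
        Prod.mk.injEq] at h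
      linarith
  subst hij
  exact ⟨rfl, faceMap_injective i h⟩

theorem faceMap_notMem_frame (i : Fin 3) {p : ℝ × ℝ} (hp : p ∈ stdTriangle) (x y : Fin 4) :
    faceMap i p ∉ segment ℝ (framePos x) (framePos y) := by
  rintro ⟨a, b, ha, hb, hab, h⟩
  obtain ⟨p1, p2, p3⟩ := hp
  have e1 := congrArg Prod.fst h
  have e2 := congrArg Prod.snd h
  fin_cases i <;> fin_cases x <;> fin_cases y <;>
  · simp [faceMap_zero, faceMap_one, faceMap_two, framePos] at e1 e2
    linarith

theorem framePos_injective : Function.Injective framePos := by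
  intro x y h
  fin_cases x <;> fin_cases y <;> first
    | rfl
    | exfalso
      simp [framePos] at h

theorem framePos_notMem_openSegment {x y : Fin 4} (hxy : x ≠ y) (z : Fin 4) :
    framePos z ∉ openSegment ℝ (framePos x) (framePos y) := by
  rintro ⟨a, b, ha, hb, hab, h⟩
  have e1 := congrArg Prod.fst h
  have e2 := congrArg Prod.snd h
  fin_cases x <;> fin_cases y <;> first
    | exact hxy rfl
    | fin_cases z <;> simp [framePos] at e1 e2 <;> linarith

theorem frame_disjoint {x y z w : Fin 4} (hxy : x < y) (hzw : z < w) (hne : ¬ (x = z ∧ y = w))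
    {p : ℝ × ℝ} (hp : p ∈ openSegment ℝ (framePos x) (framePos y)) :
    p ∉ openSegment ℝ (framePos z) (framePos w) := by
  rintro ⟨c, d, hc, hd, hcd, h⟩
  obtain ⟨a, b, ha, hb, hab, rfl⟩ := hp
  have e1 := congrArg Prod.fst h
  have e2 := congrArg Prod.snd h
  fin_cases x <;> fin_cases y <;> first
    | exact absurd hxy (by decide)
    | fin_cases z <;> fin_cases w <;> first
      | exact absurd hzw (by decide)
      | exact hne (by decide)
      | simp [framePos] at e1 e2; linarith

end Faces

section FaceDrawing

variable {V : Type*} {h₁ h₂ h₃ : V} {g : V → ℝ × ℝ}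

/-- The drawing placing one copy of `g` in each inner face of the frame. -/
def faceDrawing (g : V → ℝ × ℝ) : TVert V h₁ h₂ h₃ → ℝ × ℝ :=
  Sum.elim framePos fun p => faceMap p.2 (g p.1)

/-- The drawing `g` has the standard triangle as its hull. -/
def HasStdHull (g : V → ℝ × ℝ) (h₁ h₂ h₃ : V) : Prop :=
  g h₁ = (1, 0) ∧ g h₂ = (0, 0) ∧ g h₃ = (0, 1) ∧
    ∀ v, (v ≠ h₁ ∧ v ≠ h₂ ∧ v ≠ h₃) → g v ∈ stdTriangle

theorem faceDrawing_frameVert (x : Fin 4) :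
    faceDrawing g (frameVert h₁ h₂ h₃ x) = framePos x := rfl

theorem faceDrawing_innerVert {u : V} (hu : u ≠ h₁ ∧ u ≠ h₂ ∧ u ≠ h₃) (i : Fin 3) :
    faceDrawing g (innerVert hu i) = faceMap i (g u) := rfl

theorem frameVert_or_innerVert (p : TVert V h₁ h₂ h₃) :
    (∃ x, p = frameVert h₁ h₂ h₃ x) ∨
      ∃ (u : V) (hu : u ≠ h₁ ∧ u ≠ h₂ ∧ u ≠ h₃) (i : Fin 3), p = innerVert hu i := by
  rcases p with x | ⟨⟨u, hu⟩, i⟩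
  · exact Or.inl ⟨x, rfl⟩
  · exact Or.inr ⟨u, hu, i, rfl⟩

theorem HasStdHull.mem_closed (hg : HasStdHull g h₁ h₂ h₃) (u : V) :
    0 ≤ (g u).1 ∧ 0 ≤ (g u).2 ∧ (g u).1 + (g u).2 ≤ 1 := by
  by_cases hu : u ≠ h₁ ∧ u ≠ h₂ ∧ u ≠ h₃
  · have := hg.2.2.2 u hu
    exact ⟨this.1.le, this.2.1.le, this.2.2.le⟩
  · have hu' : u = h₁ ∨ u = h₂ ∨ u = h₃ := by tauto
    rcases hu' with rfl | rfl | rfl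
    · simp [hg.1]
    · simp [hg.2.1]
    · simp [hg.2.2.1]

theorem HasStdHull.openSegment_subset (hg : HasStdHull g h₁ h₂ h₃) {a b : V}
    (hnh : (a ≠ h₁ ∧ a ≠ h₂ ∧ a ≠ h₃) ∨ (b ≠ h₁ ∧ b ≠ h₂ ∧ b ≠ h₃)) :
    openSegment ℝ (g a) (g b) ⊆ stdTriangle := by
  have key : ∀ a b : V, (a ≠ h₁ ∧ a ≠ h₂ ∧ a ≠ h₃) →
      openSegment ℝ (g a) (g b) ⊆ stdTriangle := by
    rintro a b ha _ ⟨s, t, hs, ht, hst, rfl⟩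
    obtain ⟨a1, a2, a3⟩ := hg.2.2.2 a ha
    obtain ⟨b1, b2, b3⟩ := hg.mem_closed b
    simp only [stdTriangle, Set.mem_ofPred_eq, Prod.fst_add, Prod.snd_add, Prod.smul_fst,
      Prod.smul_snd, smul_eq_mul]
    refine ⟨by positivity, by positivity, ?_⟩
    have m1 := mul_lt_mul_of_pos_left a3 hs
    have m2 := mul_le_mul_of_nonneg_left b3 ht.le
    linarith
  rcases hnh with h | h
  · exact key a b h
  · rw [openSegment_symm]
    exact key b a h

theorem exists_of_mem_openSegment_faceMap {i : Fin 3} {p q z : ℝ × ℝ}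
    (hz : z ∈ openSegment ℝ (faceMap i p) (faceMap i q)) :
    ∃ w ∈ openSegment ℝ p q, z = faceMap i w := by
  obtain ⟨s, t, hs, ht, hst, rfl⟩ := hz
  refine ⟨s • p + t • q, ⟨s, t, hs, ht, hst, rfl⟩, ?_⟩
  simp only [faceMap, Prod.fst_add, Prod.snd_add, Prod.smul_fst, Prod.smul_snd, smul_eq_mul]
  module

theorem HasStdHull.faceDrawing_injective (hg : HasStdHull g h₁ h₂ h₃)
    (hinj : Function.Injective g) :
    Function.Injective (faceDrawing g : TVert V h₁ h₂ h₃ → ℝ × ℝ) := by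
  have hmix : ∀ (x : Fin 4) (u : V) (hu : u ≠ h₁ ∧ u ≠ h₂ ∧ u ≠ h₃) (i : Fin 3),
      framePos x ≠ faceMap i (g u) := fun x u hu i h =>
    faceMap_notMem_frame i (hg.2.2.2 u hu) x x (h ▸ left_mem_segment ℝ _ _)
  intro p q hpq
  rcases frameVert_or_innerVert p with ⟨x, rfl⟩ | ⟨u, hu, i, rfl⟩ <;>
    rcases frameVert_or_innerVert q with ⟨y, rfl⟩ | ⟨w, hw, j, rfl⟩ <;>
    simp only [faceDrawing_frameVert, faceDrawing_innerVert] at hpq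
  · rw [framePos_injective hpq]
  · exact (hmix _ _ hw _ hpq).elim
  · exact (hmix _ _ hu _ hpq.symm).elim
  · obtain ⟨rfl, h⟩ := eq_of_faceMap_eq (hg.2.2.2 u hu) (hg.2.2.2 w hw) hpq
    obtain rfl := hinj h
    rfl

variable [DecidableEq V]

theorem HasStdHull.faceDrawing_copyMap (hg : HasStdHull g h₁ h₂ h₃) (h12 : h₁ ≠ h₂)
    (h23 : h₂ ≠ h₃) (h31 : h₃ ≠ h₁) (i : Fin 3) (u : V) :
    faceDrawing g (copyMap h₁ h₂ h₃ i u) = faceMap i (g u) := by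
  by_cases hu : u ≠ h₁ ∧ u ≠ h₂ ∧ u ≠ h₃
  · rw [copyMap_of_ne i hu, faceDrawing_innerVert]
  · have hu' : u = h₁ ∨ u = h₂ ∨ u = h₃ := by tauto
    rcases hu' with rfl | rfl | rfl
    · rw [copyMap_fst h12, faceDrawing_frameVert, hg.1]
      simp [faceMap]
    · rw [copyMap_snd, faceDrawing_frameVert, hg.2.1]
      simp [faceMap, framePos]
    · rw [copyMap_trd h23 h31, faceDrawing_frameVert, hg.2.2.1]
      simp [faceMap]

theorem copyMap_mem_frame (h12 : h₁ ≠ h₂) (h23 : h₂ ≠ h₃) (h31 : h₃ ≠ h₁) (i : Fin 3) {u : V}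
    (hu : ¬ (u ≠ h₁ ∧ u ≠ h₂ ∧ u ≠ h₃)) : ∃ x, copyMap h₁ h₂ h₃ i u = frameVert h₁ h₂ h₃ x := by
  have hu' : u = h₁ ∨ u = h₂ ∨ u = h₃ := by tauto
  rcases hu' with rfl | rfl | rfl
  · exact ⟨_, copyMap_fst h12 i⟩
  · exact ⟨_, copyMap_snd i⟩
  · exact ⟨_, copyMap_trd h23 h31 i⟩

/-- An edge of `T_v` is an edge of the frame or belongs to one of the copies. -/
theorem TGraph_adj_cases (h12 : h₁ ≠ h₂) (h23 : h₂ ≠ h₃) (h31 : h₃ ≠ h₁) {v : V} {s : List V}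
    {p q : TVert V h₁ h₂ h₃} (hpq : (TGraph h₁ h₂ h₃ v s).Adj p q) :
    (∃ x y, x < y ∧ s(p, q) = s(frameVert h₁ h₂ h₃ x, frameVert h₁ h₂ h₃ y)) ∨
      ∃ i a b, (wheelGraph v s).Adj a b ∧
        ((a ≠ h₁ ∧ a ≠ h₂ ∧ a ≠ h₃) ∨ (b ≠ h₁ ∧ b ≠ h₂ ∧ b ≠ h₃)) ∧
        p = copyMap h₁ h₂ h₃ i a ∧ q = copyMap h₁ h₂ h₃ i b := by
  have hframe : ∀ x y, p = frameVert h₁ h₂ h₃ x → q = frameVert h₁ h₂ h₃ y →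
      ∃ x y, x < y ∧ s(p, q) = s(frameVert h₁ h₂ h₃ x, frameVert h₁ h₂ h₃ y) := by
    rintro x y rfl rfl
    have hxy : x ≠ y := fun h => hpq.ne (by rw [h])
    rcases lt_or_gt_of_ne hxy with h | h
    · exact ⟨x, y, h, rfl⟩
    · exact ⟨y, x, h, Sym2.eq_swap⟩
  have hcopy : ∀ i a b, (wheelGraph v s).Adj a b → p = copyMap h₁ h₂ h₃ i a →
      q = copyMap h₁ h₂ h₃ i b →
      (∃ x y, x < y ∧ s(p, q) = s(frameVert h₁ h₂ h₃ x, frameVert h₁ h₂ h₃ y)) ∨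
        ∃ i a b, (wheelGraph v s).Adj a b ∧
          ((a ≠ h₁ ∧ a ≠ h₂ ∧ a ≠ h₃) ∨ (b ≠ h₁ ∧ b ≠ h₂ ∧ b ≠ h₃)) ∧
          p = copyMap h₁ h₂ h₃ i a ∧ q = copyMap h₁ h₂ h₃ i b := by
    intro i a b hab hp hq
    by_cases hnh : (a ≠ h₁ ∧ a ≠ h₂ ∧ a ≠ h₃) ∨ (b ≠ h₁ ∧ b ≠ h₂ ∧ b ≠ h₃)
    · exact Or.inr ⟨i, a, b, hab, hnh, hp, hq⟩
    · rw [not_or] at hnh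
      obtain ⟨x, hx⟩ := copyMap_mem_frame h12 h23 h31 i hnh.1
      obtain ⟨y, hy⟩ := copyMap_mem_frame h12 h23 h31 i hnh.2
      exact Or.inl (hframe x y (hp.trans hx) (hq.trans hy))
  have hadj := hpq
  rw [TGraph, SimpleGraph.fromRel_adj] at hadj
  rcases hadj.2 with (⟨x, y, hx, hy⟩ | ⟨i, a, b, hab, hp, hq⟩) |
    (⟨x, y, hx, hy⟩ | ⟨i, a, b, hab, hp, hq⟩)
  · exact Or.inl (hframe x y hx hy)
  · exact hcopy i a b hab hp hq
  · exact Or.inl (hframe y x hy hx)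
  · exact hcopy i b a hab.symm hq hp

theorem openSegment_eq_of_sym2_eq {U : Type*} {φ : U → ℝ × ℝ} {a b c d : U}
    (h : s(a, b) = s(c, d)) :
    openSegment ℝ (φ a) (φ b) = openSegment ℝ (φ c) (φ d) := by
  rcases Sym2.eq_iff.mp h with ⟨rfl, rfl⟩ | ⟨rfl, rfl⟩
  · rfl
  · exact openSegment_symm ℝ _ _

theorem HasStdHull.isPlaneDrawing [Fintype V] {χ : V → V → V → ℤ}
    (hn : 4 ≤ Fintype.card V) (hχ : IsOrderType χ) (ht : IsHullTriangle χ h₁ h₂ h₃)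
    (hstd : HasStdHull g h₁ h₂ h₃) (hg : IsOrientedBy χ g) {v : V} {s : List V}
    (hShull : v ∈ ({h₁, h₂, h₃} : Set V) → IsHullSurroundSeq χ v s)
    (hSint : v ∉ ({h₁, h₂, h₃} : Set V) → IsInternalSurroundSeq χ v s) :
    IsPlaneDrawing (TGraph h₁ h₂ h₃ v s) (faceDrawing g) := by
  have hinj := hg.injective hχ hn
  have h12 := ht.1
  have h23 := ht.2.1
  have h31 := ht.2.2.1
  have hcopy := hstd.faceDrawing_copyMap h12 h23 h31
  have hedge : ∀ {p q : TVert V h₁ h₂ h₃}, (TGraph h₁ h₂ h₃ v s).Adj p q →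
      (∃ x y, x < y ∧ s(p, q) = s(frameVert h₁ h₂ h₃ x, frameVert h₁ h₂ h₃ y) ∧
        openSegment ℝ (faceDrawing g p) (faceDrawing g q) =
          openSegment ℝ (framePos x) (framePos y)) ∨
      ∃ i a b, a ≠ b ∧ IsWheelEdge χ v a b ∧
        s(p, q) = s(copyMap h₁ h₂ h₃ i a, copyMap h₁ h₂ h₃ i b) ∧
        ∀ z ∈ openSegment ℝ (faceDrawing g p) (faceDrawing g q),
          ∃ w ∈ openSegment ℝ (g a) (g b), w ∈ stdTriangle ∧ z = faceMap i w := by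
    intro p q hpq
    rcases TGraph_adj_cases h12 h23 h31 hpq with ⟨x, y, hxy, h⟩ | ⟨i, a, b, hab, hnh, rfl, rfl⟩
    · exact Or.inl ⟨x, y, hxy, h, openSegment_eq_of_sym2_eq h⟩
    · refine Or.inr ⟨i, a, b, hab.ne, isWheelEdge_of_adj hχ hn ht hShull hSint hab hnh, rfl,
        fun z hz => ?_⟩
      rw [hcopy, hcopy] at hz
      obtain ⟨w, hw, rfl⟩ := exists_of_mem_openSegment_faceMap hz
      exact ⟨w, hw, hstd.openSegment_subset hnh hw, rfl⟩
  refine isPlaneDrawing_of_openSegment (hstd.faceDrawing_injective hinj) ?_ ?_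
  · intro p q r hpq hr
    rcases frameVert_or_innerVert r with ⟨z, rfl⟩ | ⟨u, hu, j, rfl⟩ <;>
      rcases hedge hpq with ⟨x, y, hxy, -, he⟩ | ⟨i, a, b, hab, -, -, he⟩
    · rw [he] at hr
      exact framePos_notMem_openSegment hxy.ne z hr
    · obtain ⟨w, -, hw, h⟩ := he _ hr
      refine faceMap_notMem_frame i hw z z ?_
      rw [← h]
      exact left_mem_segment ℝ _ _
    · rw [he] at hr
      exact faceMap_notMem_frame j (hstd.2.2.2 u hu) x y (openSegment_subset_segment ℝ _ _ hr)
    · obtain ⟨w, hw, hw', h⟩ := he _ hr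
      obtain ⟨-, rfl⟩ := eq_of_faceMap_eq (hstd.2.2.2 u hu) hw' h
      exact hg.notMem_openSegment hχ hinj hab u hw
  · intro p q r t hpq hrt hne z hz hz'
    rcases hedge hpq with ⟨x, y, hxy, hs, he⟩ | ⟨i, a, b, hab, hw, hs, he⟩ <;>
      rcases hedge hrt with ⟨x', y', hxy', hs', he'⟩ | ⟨j, c, d, hcd, hw', hs', he'⟩
    · rw [he] at hz
      rw [he'] at hz'
      refine frame_disjoint hxy hxy' ?_ hz hz'
      rintro ⟨rfl, rfl⟩
      exact hne (hs.trans hs'.symm)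
    · rw [he] at hz
      obtain ⟨w, -, hw, rfl⟩ := he' z hz'
      exact faceMap_notMem_frame j hw x y (openSegment_subset_segment ℝ _ _ hz)
    · rw [he'] at hz'
      obtain ⟨w, -, hw, rfl⟩ := he z hz
      exact faceMap_notMem_frame i hw x' y' (openSegment_subset_segment ℝ _ _ hz')
    · obtain ⟨w, hwab, hwstd, rfl⟩ := he z hz
      obtain ⟨w', hwcd, hwstd', h⟩ := he' _ hz'
      obtain ⟨rfl, rfl⟩ := eq_of_faceMap_eq hwstd hwstd' h
      refine hg.not_crossing hχ hab hcd hw hw' (fun heq => hne ?_) hwab hwcd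
      rw [hs, hs']
      rcases Sym2.eq_iff.mp heq with ⟨rfl, rfl⟩ | ⟨rfl, rfl⟩
      · rfl
      · exact Sym2.eq_swap

end FaceDrawing

theorem sge_iff_realizable {V : Type*} [Fintype V] [DecidableEq V]
    (χ : V → V → V → ℤ) (hn : 4 ≤ Fintype.card V) (hχ : IsOrderType χ)
    (h₁ h₂ h₃ : V) (hhull : IsConvexHullSeq χ 3 (tripleHull h₁ h₂ h₃))
    (S : V → List V)
    (hShull : ∀ v ∈ ({h₁, h₂, h₃} : Set V), IsHullSurroundSeq χ v (S v))
    (hSint : ∀ v ∉ ({h₁, h₂, h₃} : Set V), IsInternalSurroundSeq χ v (S v)) :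
    (∃ φ : TVert V h₁ h₂ h₃ → ℝ × ℝ,
        ∀ v : V, IsPlaneDrawing (TGraph h₁ h₂ h₃ v (S v)) φ) ↔
      ∃ f : V → ℝ × ℝ, Realizes χ f := by
  have ht := hhull.isHullTriangle
  refine ⟨fun ⟨φ, hφ⟩ => exists_realizes_of_isPlaneDrawing hn hχ ht hShull hSint hφ,
    fun ⟨f, hf⟩ => ?_⟩
  obtain ⟨g, hg, hstd⟩ := exists_isOrientedBy_std ht (hf.isOrientedBy hχ)
  exact ⟨faceDrawing g, fun v =>
    HasStdHull.isPlaneDrawing hn hχ ht hstd hg (hShull v) (hSint v)⟩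
end

section
/- Let χ and χ′ be order types in general position on the same finite set V with |V| = n ≥ 4. Suppose h_1, …, h_t is a convex hull sequence of both χ and χ′; for each hull element h there is a single enumeration of V ∖ {h} that is a hull surrounding sequence of h for both χ and χ′; and for each non-hull element v there is a single enumeration of V ∖ {v} that is an internal surrounding sequence of v for both χ and χ′. Then χ = χ′. (The surrounding sequences combined with the convex hull completely determine χ.) -/
namespace IsOrderType

variable {V : Type*} {χ : V → V → V → ℤ}

theorem ne_of_ne_zero (hχ : IsOrderType χ) {a b c : V} (h : χ a b c ≠ 0) :
    a ≠ b ∧ a ≠ c ∧ b ≠ c := by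
  refine ⟨fun e => h ?_, fun e => h ?_, fun e => h ?_⟩ <;> apply hχ.2.1 <;> tauto

theorem swap_outer (hχ : IsOrderType χ) (v x y : V) : χ y v x = -χ x v y := by
  rw [hχ.2.2.1 v y, hχ.2.2.2.1 v x, hχ.2.2.1 x v, neg_neg]

/-- The Grassmann–Plücker axiom around a pivot `v` written as the middle argument. -/
theorem gp_middle (hχ : IsOrderType χ) {v a b c d : V} (hva : v ≠ a) (hvb : v ≠ b)
    (hvc : v ≠ c) (hvd : v ≠ d) (hab : a ≠ b) (hac : a ≠ c) (had : a ≠ d) (hbc : b ≠ c)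
    (hbd : b ≠ d) (hcd : c ≠ d) :
    (χ a v b * χ c v d = -1 ∨ -(χ a v c * χ b v d) = -1 ∨ χ a v d * χ b v c = -1) ∧
    (χ a v b * χ c v d = 1 ∨ -(χ a v c * χ b v d) = 1 ∨ χ a v d * χ b v c = 1) := by
  have h := hχ.2.2.2.2 v a b c d hva hvb hvc hvd hab hac had hbc hbd hcd
  simpa only [hχ.2.2.1 a v, hχ.2.2.1 b v, hχ.2.2.1 c v, neg_mul_neg] using h

/-- Around a pivot `v`, the relation `χ · v · = 1` is transitive on each open side of the
line through `a` and `v`. -/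
theorem trans_of_same_side (hχ : IsOrderType χ) {v a b c d : V} {e : ℤ} (he : e = 1 ∨ e = -1)
    (hb : χ a v b = e) (hc : χ a v c = e) (hd : χ a v d = e)
    (hbc : χ b v c = 1) (hcd : χ c v d = 1) : χ b v d = 1 := by
  have e0 : e ≠ 0 := by omega
  obtain ⟨hav, hab, hvb⟩ := hχ.ne_of_ne_zero (hb.trans_ne e0)
  obtain ⟨-, hac, hvc⟩ := hχ.ne_of_ne_zero (hc.trans_ne e0)
  obtain ⟨-, had, hvd⟩ := hχ.ne_of_ne_zero (hd.trans_ne e0)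
  obtain ⟨-, hbc', -⟩ := hχ.ne_of_ne_zero (hbc.trans_ne one_ne_zero)
  obtain ⟨-, hcd', -⟩ := hχ.ne_of_ne_zero (hcd.trans_ne one_ne_zero)
  have hbd : b ≠ d := by
    rintro rfl
    have := hχ.swap_outer v b c
    omega
  have gp := hχ.gp_middle hav.symm hvb hvc hvd hab hac had hbc' hbd hcd'
  rcases hχ.1 b v d hvb.symm hbd hvd with h | h
  · exact h
  · rw [hb, hc, hd, hbc, hcd, h] at gp
    rcases he with rfl | rfl <;> norm_num at gp

end IsOrderType

section Hull

variable {V : Type*} {χ : V → V → V → ℤ} {t : ℕ} {h : ZMod t → V}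

/-- Around a hull element `x`, the relation `χ · x · = 1` is transitive. -/
theorem IsConvexHullSeq.trans_around (hh : IsConvexHullSeq χ t h) (hχ : IsOrderType χ) {x : V}
    (hx : x ∈ Set.range h) {b c d : V} (hbc : χ b x c = 1) (hcd : χ c x d = 1) :
    χ b x d = 1 := by
  obtain ⟨i, rfl⟩ := hx
  obtain ⟨ht, hinj, hpos⟩ := hh
  have hside : ∀ v, v ≠ h i → v ≠ h (i + 1) → χ (h (i + 1)) (h i) v = -1 := fun v h₁ h₂ => by
    rw [hχ.2.2.1, hpos i v h₁ h₂]
  have hlast : ∀ v, χ (h (i + 1)) (h i) v ≠ 1 := fun v hv => by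
    obtain ⟨-, h₁, h₂⟩ := hχ.ne_of_ne_zero (hv.trans_ne one_ne_zero)
    have := hside v h₂.symm h₁.symm
    omega
  obtain ⟨hbi, -, hci⟩ := hχ.ne_of_ne_zero (hbc.trans_ne one_ne_zero)
  obtain ⟨-, -, hdi⟩ := hχ.ne_of_ne_zero (hcd.trans_ne one_ne_zero)
  have hb : b ≠ h (i + 1) := by rintro rfl; exact hlast _ hbc
  have hc : c ≠ h (i + 1) := by rintro rfl; exact hlast _ hcd
  by_cases hd : d = h (i + 1)
  · rw [hχ.swap_outer, hd, hside b hbi hb, neg_neg]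
  · exact hχ.trans_of_same_side (Or.inr rfl) (hside b hbi hb) (hside c hci.symm hc)
      (hside d hdi.symm hd) hbc hcd

/-- A hull surrounding sequence lists the remaining elements in the order around `x`. -/
theorem IsConvexHullSeq.pairwise_surround (hh : IsConvexHullSeq χ t h) (hχ : IsOrderType χ)
    {x : V} (hx : x ∈ Set.range h) {s : List V} (hs : IsHullSurroundSeq χ x s) :
    s.Pairwise (fun a b => χ a x b = 1) := by
  have : IsTrans V (fun a b => χ a x b = 1) := ⟨fun _ _ _ => hh.trans_around hχ hx⟩
  exact List.isChain_iff_pairwise.1 hs.2.2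

theorem IsConvexHullSeq.eq_around {χ' : V → V → V → ℤ} (hχ : IsOrderType χ)
    (hχ' : IsOrderType χ') (hh : IsConvexHullSeq χ t h) (hh' : IsConvexHullSeq χ' t h)
    {x : V} (hx : x ∈ Set.range h) {s : List V} (hs : IsHullSurroundSeq χ x s)
    (hs' : IsHullSurroundSeq χ' x s) (a b : V) : χ a x b = χ' a x b := by
  by_cases hdeg : a = x ∨ a = b ∨ x = b
  · rw [hχ.2.1 _ _ _ hdeg, hχ'.2.1 _ _ _ hdeg]
  push Not at hdeg
  obtain ⟨hax, hab, hxb⟩ := hdeg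
  have hp := (hh.pairwise_surround hχ hx hs).and (hh'.pairwise_surround hχ' hx hs')
  obtain ⟨i, hi, rfl⟩ := List.getElem_of_mem ((hs.2.1 a).2 hax)
  obtain ⟨j, hj, rfl⟩ := List.getElem_of_mem ((hs.2.1 b).2 hxb.symm)
  rw [List.pairwise_iff_getElem] at hp
  rcases lt_trichotomy i j with hij | rfl | hij
  · obtain ⟨h₁, h₂⟩ := hp i j hi hj hij
    rw [h₁, h₂]
  · exact absurd rfl hab
  · obtain ⟨h₁, h₂⟩ := hp j i hj hi hij
    rw [hχ.swap_outer, hχ'.swap_outer, h₁, h₂]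

end Hull

section Internal

variable {V : Type*} {χ : V → V → V → ℤ} {v : V} {s : List V}

/-- On a block of consecutive indices lying on one side of the line through `a` and `v`,
a consecutively increasing sequence is increasing. -/
theorem IsOrderType.increasing_of_same_side (hχ : IsOrderType χ) {a : V} {f : ℕ → V} {e : ℤ}
    (he : e = 1 ∨ e = -1) {i : ℕ} :
    ∀ j, i < j → (∀ k, i ≤ k → k ≤ j → χ a v (f k) = e) →
      (∀ k, i ≤ k → k < j → χ (f k) v (f (k + 1)) = 1) → χ (f i) v (f j) = 1 := by
  intro j hij
  induction j, hij using Nat.le_induction with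
  | base => intro _ h; exact h i le_rfl (Nat.lt_succ_self i)
  | succ j hij ih =>
    intro hs hc
    have hij' : i ≤ j := by omega
    exact hχ.trans_of_same_side he (hs i le_rfl (by omega)) (hs j hij' (by omega))
      (hs (j + 1) (by omega) le_rfl)
      (ih (fun k h₁ h₂ => hs k h₁ (by omega)) (fun k h₁ h₂ => hc k h₁ (by omega)))
      (hc j hij' (Nat.lt_succ_self j))

/-- Three elements in the order of an internal surrounding sequence of `v` are in
counterclockwise cyclic order around `v`: at least two of the three signs are positive. -/
theorem IsInternalSurroundSeq.one_le_cyclic_sum (hχ : IsOrderType χ)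
    (hs : IsInternalSurroundSeq χ v s) {i j k : ℕ} (hij : i < j) (hjk : j < k)
    (hk : k < s.length) :
    1 ≤ χ (s.getD i v) v (s.getD j v) + χ (s.getD j v) v (s.getD k v) +
      χ (s.getD k v) v (s.getD i v) := by
  obtain ⟨hnd, hmem, hch, -, p, ⟨hp0, hp1, hpos, hneg⟩, -⟩ := hs
  have hget : ∀ {m}, (hm : m < s.length) → s.getD m v = s[m] := fun hm => by simp [hm]
  have hne : ∀ {m}, m < s.length → v ≠ s.getD m v := fun hm => by
    rw [hget hm]; exact ((hmem _).1 (List.getElem_mem hm)).symm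
  have hinj : ∀ {m l}, m < l → l < s.length → s.getD m v ≠ s.getD l v := fun {m l} hml hl => by
    rw [hget (hml.trans hl), hget hl, Ne, hnd.getElem_inj_iff]; omega
  have hstep : ∀ m, m + 1 < s.length → χ (s.getD m v) v (s.getD (m + 1) v) = 1 := fun m hm => by
    rw [hget hm, hget (by omega)]; exact List.isChain_iff_getElem.1 hch m hm
  have sgn : ∀ {m l}, m < l → l < s.length → χ (s.getD m v) v (s.getD l v) = 1 ∨
      χ (s.getD m v) v (s.getD l v) = -1 := fun {m l} hml hl =>
    hχ.1 _ _ _ (hne (hml.trans hl)).symm (hinj hml hl) (hne hl)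
  have incl : ∀ {m l}, 0 < m → m < l → l ≤ p → χ (s.getD m v) v (s.getD l v) = 1 :=
    fun {m l} h0 hml hl => hχ.increasing_of_same_side (a := s.getD 0 v)
      (f := fun q => s.getD q v) (Or.inl rfl) l hml (fun q _ _ => hpos q (by omega) (by omega))
      (fun q _ _ => hstep q (by omega))
  have incr : ∀ {m l}, p < m → m < l → l < s.length → χ (s.getD m v) v (s.getD l v) = 1 :=
    fun {m l} h0 hml hl => hχ.increasing_of_same_side (a := s.getD 0 v)
      (f := fun q => s.getD q v) (Or.inr rfl) l hml (fun q _ _ => hneg q (by omega) (by omega))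
      (fun q _ _ => hstep q (by omega))
  have hsw := hχ.swap_outer v (s.getD i v) (s.getD k v)
  have s₁ := sgn hij (hjk.trans hk)
  have s₂ := sgn hjk hk
  have s₃ := sgn (hij.trans hjk) hk
  rw [hsw]
  have side : ∀ m, 0 < m → m < s.length →
      (m ≤ p ∧ χ (s.getD 0 v) v (s.getD m v) = 1) ∨
      (p < m ∧ χ (s.getD 0 v) v (s.getD m v) = -1) := fun m h0 hm => by
    rcases le_or_gt m p with h | h
    · exact Or.inl ⟨h, hpos m h0 h⟩
    · exact Or.inr ⟨h, hneg m h hm⟩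
  have sj := side j (by omega) (by omega)
  have sk := side k (by omega) hk
  have aj : j ≤ p → 0 < i → _ := fun h h0 => incl h0 hij h
  have ak : k ≤ p → _ := fun h => incl (by omega) hjk h
  have bk : p < j → _ := fun h => incr h hjk hk
  have bj : p < i → _ := fun h => incr h hij (hjk.trans hk)
  rcases Nat.eq_zero_or_pos i with rfl | hi
  · omega
  have si := side i hi (by omega)
  have gp := hχ.gp_middle (hne (m := 0) (by omega)) (hne (m := i) (by omega))
    (hne (m := j) (by omega)) (hne hk) (hinj hi (by omega)) (hinj (hi.trans hij) (by omega))
    (hinj (by omega) hk) (hinj hij (by omega)) (hinj (hij.trans hjk) hk) (hinj hjk hk)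
  rcases si with ⟨hi', si⟩ | ⟨hi', si⟩ <;> rcases sj with ⟨hj', sj⟩ | ⟨hj', sj⟩ <;>
    rcases sk with ⟨hk', sk⟩ | ⟨hk', sk⟩ <;> rw [si, sj, sk] at gp <;> omega

/-- If `b` and `c` lie on the same side of the line through `x` and `v` in both order types,
then a common internal surrounding sequence of `v` determines the sign of `b, v, c`. -/
theorem IsInternalSurroundSeq.eq_of_same_side {χ' : V → V → V → ℤ} (hχ : IsOrderType χ)
    (hχ' : IsOrderType χ') (hs : IsInternalSurroundSeq χ v s)
    (hs' : IsInternalSurroundSeq χ' v s) {x b c : V} (hx : x ≠ v) (hb : b ≠ v) (hc : c ≠ v)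
    (hxb : x ≠ b) (hxc : x ≠ c) (hbc : b ≠ c)
    (hside : χ x v b = χ x v c) (hside' : χ' x v b = χ' x v c) : χ b v c = χ' b v c := by
  have index : ∀ y, y ≠ v → ∃ i, i < s.length ∧ s.getD i v = y := fun y hy => by
    obtain ⟨i, hi, rfl⟩ := List.getElem_of_mem ((hs.2.1 y).2 hy)
    exact ⟨i, hi, by simp [hi]⟩
  have key := fun i j k => hs.one_le_cyclic_sum (i := i) (j := j) (k := k) hχ
  have key' := fun i j k => hs'.one_le_cyclic_sum (i := i) (j := j) (k := k) hχ'
  have sgn := hχ.1 b v c hb hbc hc.symm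
  have sgn' := hχ'.1 b v c hb hbc hc.symm
  have w₁ := hχ.swap_outer v x b
  have w₂ := hχ.swap_outer v x c
  have w₃ := hχ.swap_outer v b c
  have w₁' := hχ'.swap_outer v x b
  have w₂' := hχ'.swap_outer v x c
  have w₃' := hχ'.swap_outer v b c
  obtain ⟨i, hi, rfl⟩ := index x hx
  obtain ⟨j, hj, rfl⟩ := index b hb
  obtain ⟨k, hk, rfl⟩ := index c hc
  have hij : i ≠ j := by rintro rfl; exact hxb rfl
  have hik : i ≠ k := by rintro rfl; exact hxc rfl
  have hjk : j ≠ k := by rintro rfl; exact hbc rfl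
  rcases lt_or_gt_of_ne hij with h₁ | h₁ <;> rcases lt_or_gt_of_ne hik with h₂ | h₂ <;>
    rcases lt_or_gt_of_ne hjk with h₃ | h₃
  · have := key i j k h₁ h₃ hk; have := key' i j k h₁ h₃ hk; omega
  · have := key i k j h₂ h₃ hj; have := key' i k j h₂ h₃ hj; omega
  · omega
  · have := key k i j h₂ h₁ hj; have := key' k i j h₂ h₁ hj; omega
  · have := key j i k h₁ h₂ hk; have := key' j i k h₁ h₂ hk; omega
  · omega
  · have := key j k i h₃ h₂ hi; have := key' j k i h₃ h₂ hi; omega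
  · have := key k j i h₃ h₁ hi; have := key' k j i h₃ h₁ hi; omega

end Internal

theorem surrounding_seqs_determine {V : Type*} [Fintype V] [DecidableEq V]
    (χ χ' : V → V → V → ℤ) (hn : 4 ≤ Fintype.card V)
    (hχ : IsOrderType χ) (hχ' : IsOrderType χ')
    (t : ℕ) (h : ZMod t → V)
    (hhull : IsConvexHullSeq χ t h) (hhull' : IsConvexHullSeq χ' t h)
    (S : V → List V)
    (hShull : ∀ v ∈ Set.range h,
      IsHullSurroundSeq χ v (S v) ∧ IsHullSurroundSeq χ' v (S v))
    (hSint : ∀ v ∉ Set.range h,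
      IsInternalSurroundSeq χ v (S v) ∧ IsInternalSurroundSeq χ' v (S v)) :
    χ = χ' := by
  have hull : ∀ x ∈ Set.range h, ∀ a b, χ a x b = χ' a x b := fun x hx =>
    hhull.eq_around hχ hχ' hhull' hx (hShull x hx).1 (hShull x hx).2
  have hx₀ : h 0 ∈ Set.range h := ⟨0, rfl⟩
  generalize h 0 = x at hx₀
  -- The sign of `b, v, c` agrees as soon as `b, c` are on the same side of `v` seen from `x`.
  have around : ∀ v b c, x ≠ v → x ≠ b → x ≠ c → b ≠ v → c ≠ v → b ≠ c →
      χ v x b = χ v x c → χ b v c = χ' b v c := by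
    intro v b c hxv hxb hxc hbv hcv hbc hside
    by_cases hv : v ∈ Set.range h
    · exact hull v hv b c
    · refine (hSint v hv).1.eq_of_same_side hχ hχ' (hSint v hv).2 hxv hbv hcv hxb hxc hbc ?_ ?_
      · rw [hχ.2.2.1 v x, hχ.2.2.1 v x, hside]
      · rw [hχ'.2.2.1 v x, hχ'.2.2.1 v x, ← hull x hx₀, ← hull x hx₀, hside]
  funext a b c
  by_cases hdeg : a = b ∨ a = c ∨ b = c
  · rw [hχ.2.1 _ _ _ hdeg, hχ'.2.1 _ _ _ hdeg]
  push Not at hdeg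
  obtain ⟨hab, hac, hbc⟩ := hdeg
  by_cases hxa : x = a
  · rw [hχ.2.2.1 b a, hχ'.2.2.1 b a, hull a (hxa ▸ hx₀)]
  by_cases hxb : x = b
  · exact hull b (hxb ▸ hx₀) a c
  by_cases hxc : x = c
  · rw [hχ.2.2.2.1 a c, hχ'.2.2.2.1 a c, hull c (hxc ▸ hx₀)]
  have s₁ := hχ.1 a x b (Ne.symm hxa) hab hxb
  have s₂ := hχ.1 b x c (Ne.symm hxb) hbc hxc
  have s₃ := hχ.1 c x a (Ne.symm hxc) hac.symm hxa
  have w₁ := hχ.swap_outer x a b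
  have w₂ := hχ.swap_outer x b c
  have w₃ := hχ.swap_outer x c a
  by_cases ha : χ a x b = χ a x c
  · rw [hχ.2.2.1 b a, hχ'.2.2.1 b a, around a b c hxa hxb hxc hab.symm hac.symm hbc ha]
  by_cases hb : χ b x a = χ b x c
  · exact around b a c hxb hxa hxc hab hbc.symm hac hb
  by_cases hc : χ c x a = χ c x b
  · rw [hχ.2.2.2.1 a c, hχ'.2.2.2.1 a c, around c a b hxc hxa hxb hac hbc hab hc]
  -- Otherwise `a, b, c` would be cyclically ordered around the hull element `x`.
  have t₁ : χ a x b = 1 → χ b x c = 1 → χ a x c = 1 := hhull.trans_around hχ hx₀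
  have t₂ : χ c x b = 1 → χ b x a = 1 → χ c x a = 1 := hhull.trans_around hχ hx₀
  omega
end

section
/- Let χ be an order type in general position on a finite set V with |V| = n ≥ 4, let h be a hull element of χ, and let v_1, …, v_{n−1} be a hull surrounding sequence of h. Then for all distinct u, w ∈ V ∖ {h}: χ(u, h, w) = +1 if and only if u occurs before w in the sequence v_1, …, v_{n−1}. -/
/-- Two distinct members of a list occur in it in one of the two possible orders. -/
theorem List.pair_sublist_or_of_mem {α : Type*} {a b : α} (hab : a ≠ b) {l : List α}
    (ha : a ∈ l) (hb : b ∈ l) : [a, b].Sublist l ∨ [b, a].Sublist l := by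
  induction l with
  | nil => simp at ha
  | cons x l ih =>
    rcases List.mem_cons.1 ha with rfl | hal
    · have hbl := (List.mem_cons.1 hb).resolve_left hab.symm
      exact Or.inl ((List.singleton_sublist.2 hbl).cons_cons _)
    · rcases List.mem_cons.1 hb with rfl | hbl
      · exact Or.inr ((List.singleton_sublist.2 hal).cons_cons _)
      · exact (ih hal hbl).imp (fun h => h.cons _) (fun h => h.cons _)

/-- A hull element `h` has a successor `g` on the hull, with all other elements on the
positive side of `h, g`. -/
theorem IsHullElement.exists_successor {V : Type*} {χ : V → V → V → ℤ} {h : V}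
    (hh : IsHullElement χ h) :
    ∃ g, g ≠ h ∧ ∀ v, v ≠ h → v ≠ g → χ h g v = 1 := by
  obtain ⟨t, f, ⟨ht, hf, hpos⟩, i, rfl⟩ := hh
  have : Fact (1 < t) := ⟨by omega⟩
  refine ⟨f (i + 1), fun e => ?_, hpos i⟩
  have := hf e
  simp at this

/-- The radial relation around a hull element is transitive. -/
theorem IsOrderType.radial_trans {V : Type*} {χ : V → V → V → ℤ} (hχ : IsOrderType χ)
    {h : V} (hh : IsHullElement χ h) {a b c : V} (hab : χ a h b = 1) (hbc : χ b h c = 1) :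
    χ a h c = 1 := by
  obtain ⟨-, hzero, hswap, hswap', hGP⟩ := hχ
  obtain ⟨g, hg, hpos⟩ := hh.exists_successor
  have ne_of_one : ∀ {x y z : V}, χ x y z = 1 → x ≠ y ∧ x ≠ z ∧ y ≠ z := by
    intro x y z e
    refine ⟨?_, ?_, ?_⟩ <;> intro e' <;> have := hzero x y z (by tauto) <;> omega
  obtain ⟨hah, hab', hhb⟩ := ne_of_one hab
  obtain ⟨hbh, hbc', hhc⟩ := ne_of_one hbc
  have hac : a ≠ c := by
    rintro rfl
    have := hswap a h b
    have := hswap' h a b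
    have := hswap b h a
    omega
  have hlast : ∀ v, v ≠ h → v ≠ g → χ h v g = -1 := fun v h1 h2 => by
    rw [hswap', hpos v h1 h2]
  have hfirst : ∀ v, χ g h v ≠ 1 := by
    intro v e
    obtain ⟨-, h2, h3⟩ := ne_of_one e
    have := hpos v h3.symm h2.symm
    have := hswap h g v
    omega
  have hag : a ≠ g := by rintro rfl; exact hfirst _ hab
  have hbg : b ≠ g := by rintro rfl; exact hfirst _ hbc
  have eab := hswap a h b
  have ebc := hswap b h c
  have eac := hswap a h c
  have ag := hlast a hah hag
  by_cases hcg : c = g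
  · subst hcg
    omega
  have gp := (hGP h a b c g hah.symm hhb hhc hg.symm hab' hac hag hbc' hbg hcg).1
  rw [ag, hlast b hbh hbg, hlast c hhc.symm hcg] at gp
  omega

theorem chi_hull_iff_before {V : Type*} [Fintype V] [DecidableEq V]
    (χ : V → V → V → ℤ) (hn : 4 ≤ Fintype.card V) (hχ : IsOrderType χ)
    (h : V) (hh : IsHullElement χ h)
    (s : List V) (hs : IsHullSurroundSeq χ h s)
    (u w : V) (hu : u ≠ h) (hw : w ≠ h) (huw : u ≠ w) :
    χ u h w = 1 ↔ [u, w].Sublist s := by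
  obtain ⟨-, hmem, hchain⟩ := hs
  have : IsTrans V (fun a b => χ a h b = 1) := ⟨fun _ _ _ => hχ.radial_trans hh⟩
  have hsub : ∀ {a b : V}, [a, b].Sublist s → χ a h b = 1 := fun hab =>
    List.pairwise_iff_forall_sublist.1 (List.isChain_iff_pairwise.1 hchain) hab
  refine ⟨fun e => ?_, hsub⟩
  refine (List.pair_sublist_or_of_mem huw ((hmem u).2 hu) ((hmem w).2 hw)).resolve_right ?_
  intro hwu
  have hwhw := hχ.radial_trans hh (hsub hwu) e
  have := hχ.2.1 w h w (by simp)
  omega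
end
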